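/- arXiv:2308.10404 — 4 statements merged into one kernel-verified Lean document; each statement's English description precedes it below -/
import Mathlib

section
/- Let K ⊂ ℝ^d be the homogeneous self-similar set generated by the IFS Φ = {f_b(x) = ρOx + b : b ∈ D}, where 0 < ρ < 1, O is a d×d orthogonal matrix, and D ⊂ ℝ^d is finite with #D ≥ 2. Suppose the IFS Ψ = {g_b(x) = ρOx + b : b ∈ D − D} satisfies the strong separation condition. Then there exists a constant β < dim_H K such that for any two non-empty sets K₁, K₂ ⊂ ℝ^d with K₁ + K₂ ⊂ K, we have dim_H K₁ + dim_H K₂ ≤ 2β. In particular, β can be taken to be γ/(−2 log ρ), where γ = max{log m + log(#D + 1 − m) : m ∈ {1, 2, …, #D}}. -/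
open Pointwise

section SelfSimilarCoding

open Set Filter Topology MeasureTheory

/-- `dig` and `shift` read off the first digit and the remainder of the `D`-ary coding of points
of `K`, and the coding of a difference of two points of `K` is determined by the difference. -/
structure IsDifferenceCoding {E : Type*} [NormedAddCommGroup E] [NormedSpace ℝ E] (A : E →L[ℝ] E)
    (D : Finset E) (K : Set E) (dig shift : E → E) : Prop where
  dig_mem : ∀ x ∈ K, dig x ∈ D
  shift_mem : ∀ x ∈ K, shift x ∈ K
  eq : ∀ x ∈ K, x = A (shift x) + dig x
  add_mem : ∀ x ∈ K, ∀ b ∈ D, A x + b ∈ K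
  dig_add : ∀ x ∈ K, ∀ b ∈ D, dig (A x + b) = b
  shift_add : ∀ x ∈ K, ∀ b ∈ D, shift (A x + b) = x
  dig_sub : ∀ x ∈ K, ∀ y ∈ K, ∀ x' ∈ K, ∀ y' ∈ K, x - y = x' - y' →
    dig x - dig y = dig x' - dig y'
  shift_sub : ∀ x ∈ K, ∀ y ∈ K, ∀ x' ∈ K, ∀ y' ∈ K, x - y = x' - y' →
    shift x - shift y = shift x' - shift y'

theorem exists_isDifferenceCoding {E : Type*} [NormedAddCommGroup E] [NormedSpace ℝ E]
    {A : E →L[ℝ] E} {D : Finset E} {K : Set E} (hA : Function.Injective A)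
    (hK : K = ⋃ b ∈ D, (fun x => A x + b) '' K)
    (hSSC : ∀ t ∈ (D : Set E) - (D : Set E), ∀ t' ∈ (D : Set E) - (D : Set E), t ≠ t' →
      Disjoint ((fun x => A x + t) '' (K - K)) ((fun x => A x + t') '' (K - K))) :
    ∃ dig shift, IsDifferenceCoding A D K dig shift := by
  have key : ∀ t ∈ (D : Set E) - (D : Set E), ∀ t' ∈ (D : Set E) - (D : Set E),
      ∀ u ∈ K - K, ∀ u' ∈ K - K, A u + t = A u' + t' → t = t' ∧ u = u' := by
    intro t ht t' ht' u hu u' hu' h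
    have htt : t = t' := by
      by_contra hne
      exact Set.disjoint_left.1 (hSSC t ht t' ht' hne) ⟨u, hu, rfl⟩ ⟨u', hu', h.symm⟩
    subst htt
    exact ⟨rfl, hA (add_right_cancel h)⟩
  have hex : ∀ x, ∃ b y, x ∈ K → b ∈ D ∧ y ∈ K ∧ x = A y + b := by
    intro x
    by_cases hx : x ∈ K
    · have hx' := hx
      rw [hK] at hx'
      simp only [mem_iUnion, mem_image] at hx'
      obtain ⟨b, hb, y, hy, rfl⟩ := hx'
      exact ⟨b, y, fun _ => ⟨hb, hy, rfl⟩⟩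
    · exact ⟨0, 0, fun h => absurd h hx⟩
  choose dig shift h using hex
  have hadd : ∀ x ∈ K, ∀ b ∈ D, A x + b ∈ K := by
    intro x hx b hb
    rw [hK]
    simp only [mem_iUnion, mem_image]
    exact ⟨b, hb, x, hx, rfl⟩
  have huniq : ∀ x ∈ K, ∀ b ∈ D, dig (A x + b) = b ∧ shift (A x + b) = x := by
    intro x hx b hb
    obtain ⟨h1, h2, h3⟩ := h _ (hadd x hx b hb)
    set z := A x + b
    have := key (dig z - b) (sub_mem_sub h1 hb) (b - b) (sub_mem_sub hb hb) (shift z - x)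
      (sub_mem_sub h2 hx) (x - x) (sub_mem_sub hx hx) (by
        have : A x + b = A (shift z) + dig z := h3
        simp only [map_sub, sub_self, map_zero, add_zero]
        rw [show A (shift z) - A x + (dig z - b) = (A (shift z) + dig z) - (A x + b) by abel,
          this, sub_self])
    simpa [sub_eq_zero] using this
  have hdiff : ∀ x ∈ K, ∀ y ∈ K, ∀ x' ∈ K, ∀ y' ∈ K, x - y = x' - y' →
      dig x - dig y = dig x' - dig y' ∧ shift x - shift y = shift x' - shift y' := by
    intro x hx y hy x' hx' y' hy' hd
    obtain ⟨a1, a2, a3⟩ := h x hx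
    obtain ⟨b1, b2, b3⟩ := h y hy
    obtain ⟨c1, c2, c3⟩ := h x' hx'
    obtain ⟨d1, d2, d3⟩ := h y' hy'
    refine key _ (sub_mem_sub a1 b1) _ (sub_mem_sub c1 d1) _ (sub_mem_sub a2 b2) _
      (sub_mem_sub c2 d2) ?_
    calc A (shift x - shift y) + (dig x - dig y)
        = (A (shift x) + dig x) - (A (shift y) + dig y) := by rw [map_sub]; abel
      _ = (A (shift x') + dig x') - (A (shift y') + dig y') := by rw [← a3, ← b3, ← c3, ← d3, hd]
      _ = _ := by rw [map_sub]; abel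
  exact ⟨dig, shift, fun x hx => (h x hx).1, fun x hx => (h x hx).2.1, fun x hx => (h x hx).2.2,
    hadd, fun x hx b hb => (huniq x hx b hb).1, fun x hx b hb => (huniq x hx b hb).2,
    fun x hx y hy x' hx' y' hy' e => (hdiff x hx y hy x' hx' y' hy' e).1,
    fun x hx y hy x' hx' y' hy' e => (hdiff x hx y hy x' hx' y' hy' e).2⟩

namespace IsDifferenceCoding

variable {E : Type*} [NormedAddCommGroup E] [NormedSpace ℝ E] {A : E →L[ℝ] E} {D : Finset E}
  {K : Set E} {dig shift : E → E}

theorem iterate_mem (hc : IsDifferenceCoding A D K dig shift) {x : E} (hx : x ∈ K) (n : ℕ) :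
    shift^[n] x ∈ K :=
  Set.MapsTo.iterate (fun x hx => hc.shift_mem x hx) n hx

theorem iterate_sub (hc : IsDifferenceCoding A D K dig shift) (n : ℕ) {x y x' y' : E} (hx : x ∈ K)
    (hy : y ∈ K) (hx' : x' ∈ K) (hy' : y' ∈ K) (h : x - y = x' - y') :
    shift^[n] x - shift^[n] y = shift^[n] x' - shift^[n] y' := by
  induction n with
  | zero => exact h
  | succ n ih =>
    simp only [Function.iterate_succ_apply']
    exact hc.shift_sub _ (hc.iterate_mem hx n) _ (hc.iterate_mem hy n) _ (hc.iterate_mem hx' n) _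
      (hc.iterate_mem hy' n) ih

theorem dig_iterate_sub (hc : IsDifferenceCoding A D K dig shift) (n : ℕ) {x y x' y' : E}
    (hx : x ∈ K) (hy : y ∈ K) (hx' : x' ∈ K) (hy' : y' ∈ K) (h : x - y = x' - y') :
    dig (shift^[n] x) - dig (shift^[n] y) = dig (shift^[n] x') - dig (shift^[n] y') :=
  hc.dig_sub _ (hc.iterate_mem hx n) _ (hc.iterate_mem hy n) _ (hc.iterate_mem hx' n) _
    (hc.iterate_mem hy' n) (hc.iterate_sub n hx hy hx' hy' h)

theorem dist_eq_of_dig_eq (hc : IsDifferenceCoding A D K dig shift) {ρ : ℝ}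
    (hA : ∀ x, ‖A x‖ = ρ * ‖x‖) (n : ℕ) {x y : E} (hx : x ∈ K) (hy : y ∈ K)
    (h : ∀ k < n, dig (shift^[k] x) = dig (shift^[k] y)) :
    dist x y = ρ ^ n * dist (shift^[n] x) (shift^[n] y) := by
  induction n with
  | zero => simp
  | succ n ih =>
    rw [ih fun k hk => h k (hk.trans n.lt_succ_self), Function.iterate_succ_apply',
      Function.iterate_succ_apply', pow_succ, mul_assoc]
    congr 1
    conv_lhs => rw [hc.eq _ (hc.iterate_mem hx n), hc.eq _ (hc.iterate_mem hy n),
      h n n.lt_succ_self]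
    rw [dist_add_right, dist_eq_norm, ← map_sub, hA, dist_eq_norm]

theorem exists_pos_le_dist (hc : IsDifferenceCoding A D K dig shift) (hKc : IsCompact K) :
    ∃ δ > 0, ∀ x ∈ K, ∀ y ∈ K, dig x ≠ dig y → δ ≤ dist x y := by
  classical
  set S : Set E := ⋃ p ∈ D.offDiag, (fun z : E × E => (A z.1 + p.1) - (A z.2 + p.2)) '' (K ×ˢ K)
    with hS
  have hSc : IsClosed S := by
    refine IsCompact.isClosed (Finset.isCompact_biUnion _ fun p _ => ?_)
    exact (hKc.prod hKc).image (by fun_prop)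
  have h0 : (0 : E) ∈ Sᶜ := by
    intro h
    simp only [hS, mem_iUnion, mem_image, Finset.mem_offDiag] at h
    obtain ⟨p, ⟨hp1, hp2, hne⟩, z, ⟨hz1, hz2⟩, h⟩ := h
    apply hne
    rw [← hc.dig_add _ hz1 _ hp1, sub_eq_zero.1 h, hc.dig_add _ hz2 _ hp2]
  obtain ⟨δ, hδ, hb⟩ := Metric.isOpen_iff.1 hSc.isOpen_compl 0 h0
  refine ⟨δ, hδ, fun x hx y hy hne => ?_⟩
  by_contra! hlt
  have hmem : x - y ∈ Metric.ball (0 : E) δ := by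
    rwa [mem_ball_zero_iff, ← dist_eq_norm]
  refine hb hmem ?_
  simp only [hS, mem_iUnion, mem_image, Finset.mem_offDiag]
  refine ⟨(dig x, dig y), ⟨hc.dig_mem x hx, hc.dig_mem y hy, hne⟩, (shift x, shift y),
    ⟨hc.shift_mem x hx, hc.shift_mem y hy⟩, ?_⟩
  dsimp only
  rw [← hc.eq x hx, ← hc.eq y hy]

theorem exists_dig_eq (hc : IsDifferenceCoding A D K dig shift) (hKc : IsCompact K)
    (hKne : K.Nonempty) {ω : ℕ → E} (hω : ∀ n, ω n ∈ D) :
    ∃ x ∈ K, ∀ n, dig (shift^[n] x) = ω n := by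
  let C : ℕ → (ℕ → E) → Set E := fun n => Nat.rec (fun _ => K)
    (fun _ S ω => (fun x => A x + ω 0) '' S (fun k => ω (k + 1))) n
  have hCs : ∀ n ω, C (n + 1) ω = (fun x => A x + ω 0) '' C n (fun k => ω (k + 1)) :=
    fun _ _ => rfl
  have hcomp : ∀ n ω, IsCompact (C n ω) := by
    intro n
    induction n with
    | zero => exact fun _ => hKc
    | succ n ih => exact fun ω => (ih _).image (by fun_prop)
  have hne : ∀ n ω, (C n ω).Nonempty := by
    intro n
    induction n with
    | zero => exact fun _ => hKne
    | succ n ih => exact fun ω => (ih _).image _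
  have hanti : ∀ n ω, (∀ k, ω k ∈ D) → C (n + 1) ω ⊆ C n ω := by
    intro n
    induction n with
    | zero =>
      rintro ω hω _ ⟨x, hx, rfl⟩
      exact hc.add_mem x hx _ (hω 0)
    | succ n ih =>
      intro ω hω
      rw [hCs (n + 1), hCs n]
      exact image_mono (ih _ fun k => hω (k + 1))
  have hsub : ∀ n ω, (∀ k, ω k ∈ D) → ∀ x ∈ C n ω, x ∈ K ∧
      ∀ k < n, dig (shift^[k] x) = ω k := by
    intro n
    induction n with
    | zero => exact fun ω _ x hx => ⟨hx, by simp⟩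
    | succ n ih =>
      rintro ω hω _ ⟨x, hx, rfl⟩
      obtain ⟨h1, h2⟩ := ih _ (fun k => hω (k + 1)) x hx
      refine ⟨hc.add_mem x h1 _ (hω 0), fun k hk => ?_⟩
      cases k with
      | zero => exact hc.dig_add x h1 _ (hω 0)
      | succ k =>
        rw [Function.iterate_succ_apply, hc.shift_add x h1 _ (hω 0)]
        exact h2 k (by omega)
  obtain ⟨x, hx⟩ := IsCompact.nonempty_iInter_of_sequence_nonempty_isCompact_isClosed
    (fun n => C n ω) (fun n => hanti n ω hω) (fun n => hne n ω) (hcomp 0 ω)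
    (fun n => (hcomp n ω).isClosed)
  rw [mem_iInter] at hx
  exact ⟨x, hx 0, fun n => (hsub (n + 1) ω hω x (hx (n + 1))).2 n n.lt_succ_self⟩

theorem le_dimH (hc : IsDifferenceCoding A D K dig shift) {ρ : ℝ} (hρ0 : 0 < ρ) (hρ1 : ρ < 1)
    (hA : ∀ x, ‖A x‖ = ρ * ‖x‖) (hD : 2 ≤ D.card) (hKc : IsCompact K) (hKne : K.Nonempty) :
    ENNReal.ofReal (Real.log D.card / -Real.log ρ) ≤ dimH K := by
  set N := D.card with hN
  have : NeZero N := ⟨by omega⟩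
  obtain ⟨δ, hδ, hsep⟩ := hc.exists_pos_le_dist hKc
  let g : Fin N → E := fun i => D.equivFin.symm i
  have hg : Function.Injective g := Subtype.val_injective.comp D.equivFin.symm.injective
  have hgD : ∀ i, g i ∈ D := fun i => (D.equivFin.symm i).2
  let e : E → Fin N := Function.invFun g
  have heg : ∀ i, e (g i) = i := Function.leftInverse_invFun hg
  let φ : E → ℝ := fun x => Real.ofDigits fun n => e (dig (shift^[n] x))
  have hNpos : (0 : ℝ) < N := by positivity
  have hlogN : 0 < Real.log N := Real.log_pos (by exact_mod_cast hD)
  have hlogρ : Real.log ρ < 0 := Real.log_neg hρ0 hρ1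
  set r : ℝ := Real.log N / -Real.log ρ with hr
  have hrpos : 0 < r := div_pos hlogN (by linarith)
  have hρr : ρ ^ r = (N : ℝ)⁻¹ := by
    rw [Real.rpow_def_of_pos hρ0, hr, ← Real.exp_log (inv_pos.2 hNpos), Real.log_inv]
    congr 1
    field_simp [hlogρ.ne]
  have hholder : ∀ x ∈ K, ∀ y ∈ K, |φ x - φ y| ≤ (δ⁻¹) ^ r * dist x y ^ r := by
    intro x hx y hy
    by_cases hall : ∀ n, dig (shift^[n] x) = dig (shift^[n] y)
    · have : φ x = φ y := by simp only [φ, hall]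
      rw [this, sub_self, abs_zero]
      positivity
    · push Not at hall
      classical
      set n := Nat.find hall with hn
      have hne := Nat.find_spec hall
      have hlt : ∀ k < n, dig (shift^[k] x) = dig (shift^[k] y) := fun k hk => by
        simpa using Nat.find_min hall hk
      have h1 : |φ x - φ y| ≤ ((N : ℝ) ^ n)⁻¹ :=
        Real.abs_ofDigits_sub_ofDigits_le fun k hk => by rw [hlt k hk]
      have h2 : ρ ^ n * δ ≤ dist x y := by
        rw [hc.dist_eq_of_dig_eq hA n hx hy hlt]
        gcongr
        exact hsep _ (hc.iterate_mem hx n) _ (hc.iterate_mem hy n) hne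
      calc |φ x - φ y| ≤ ((N : ℝ) ^ n)⁻¹ := h1
        _ = (ρ ^ n) ^ r := by
          rw [← inv_pow, ← hρr, ← Real.rpow_natCast, ← Real.rpow_natCast, ← Real.rpow_mul hρ0.le,
            ← Real.rpow_mul hρ0.le, mul_comm]
        _ ≤ (δ⁻¹ * dist x y) ^ r := by
          refine Real.rpow_le_rpow (by positivity) ?_ hrpos.le
          rw [inv_mul_eq_div, le_div_iff₀ hδ]
          exact h2
        _ = _ := Real.mul_rpow (by positivity) dist_nonneg
  have hH : HolderOnWith (Real.toNNReal ((δ⁻¹) ^ r)) (Real.toNNReal r) φ K := by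
    intro x hx y hy
    rw [edist_dist, edist_dist, Real.coe_toNNReal _ hrpos.le,
      ENNReal.ofReal_rpow_of_nonneg dist_nonneg hrpos.le]
    change _ ≤ ENNReal.ofReal _ * _
    rw [← ENNReal.ofReal_mul (by positivity)]
    exact ENNReal.ofReal_le_ofReal (hholder x hx y hy)
  have hsurj : Icc (0 : ℝ) 1 ⊆ φ '' K := by
    intro t ht
    obtain ⟨a, -, rfl⟩ := Real.ofDigits_SurjOn (show 1 < N by omega) ht
    obtain ⟨x, hx, hxa⟩ := hc.exists_dig_eq hKc hKne (ω := fun n => g (a n)) fun n => hgD _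
    exact ⟨x, hx, by simp only [φ, hxa, heg]⟩
  have h1 : (1 : ENNReal) ≤ dimH K / ENNReal.ofReal r := by
    calc (1 : ENNReal) = dimH (Icc (0 : ℝ) 1) := by
          rw [Real.dimH_of_nonempty_interior (by simp)]; simp
      _ ≤ dimH (φ '' K) := dimH_mono hsurj
      _ ≤ _ := hH.dimH_image_le (Real.toNNReal_pos.2 hrpos)
  have := ENNReal.mul_le_of_le_div h1
  rwa [one_mul] at this

theorem dimH_le_of_frequently [MeasurableSpace E] [BorelSpace E]
    (hc : IsDifferenceCoding A D K dig shift) {ρ : ℝ} (hρ0 : 0 < ρ) (hρ1 : ρ < 1)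
    (hA : ∀ x, ‖A x‖ = ρ * ‖x‖) (hKc : IsCompact K) {S : Set E} (hS : S ⊆ K) {W : ℕ → Finset E}
    (hWne : ∀ n, (W n).Nonempty) (hW : ∀ x ∈ S, ∀ n, dig (shift^[n] x) ∈ W n) {s : ℝ}
    (h : ∃ᶠ n in atTop, (∏ k : Fin n, ((W k).card : ℝ)) * (ρ ^ s) ^ n ≤ 1) :
    0 ≤ s ∧ dimH S ≤ ENNReal.ofReal s := by
  have hs : 0 ≤ s := by
    by_contra! hs
    obtain ⟨n, hn, hn1⟩ := (h.and_eventually (eventually_ge_atTop 1)).exists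
    refine hn.not_gt (one_lt_mul_of_le_of_lt ?_ ?_)
    · exact_mod_cast Nat.one_le_iff_ne_zero.2
        (Finset.prod_ne_zero_iff.2 fun (k : Fin n) _ => (hWne k).card_ne_zero)
    · exact one_lt_pow₀ (Real.one_lt_rpow_of_pos_of_lt_one_of_neg hρ0 hρ1 hs) (by omega)
  refine ⟨hs, ?_⟩
  obtain ⟨C, hC0, hC⟩ : ∃ C : ℝ, 0 ≤ C ∧ ∀ x ∈ K, ∀ y ∈ K, dist x y ≤ C :=
    ⟨Metric.diam K, Metric.diam_nonneg, fun x hx y hy =>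
      Metric.dist_le_diam_of_mem hKc.isBounded hx hy⟩
  let t : ∀ n : ℕ, (∀ k : Fin n, W k) → Set E := fun n u =>
    {x ∈ S | ∀ k : Fin n, dig (shift^[k] x) = u k}
  have hdiam : ∀ n u, Metric.ediam (t n u) ≤ ENNReal.ofReal (ρ ^ n * C) := by
    intro n u
    refine Metric.ediam_le fun x hx y hy => ?_
    rw [edist_dist]
    refine ENNReal.ofReal_le_ofReal ?_
    rw [hc.dist_eq_of_dig_eq hA n (hS hx.1) (hS hy.1) fun k hk =>
      (hx.2 ⟨k, hk⟩).trans (hy.2 ⟨k, hk⟩).symm]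
    gcongr
    exact hC _ (hc.iterate_mem (hS hx.1) n) _ (hc.iterate_mem (hS hy.1) n)
  have hlim : Tendsto (fun n : ℕ => ENNReal.ofReal (ρ ^ n * C)) atTop (𝓝 0) := by
    rw [← ENNReal.ofReal_zero]
    refine ENNReal.tendsto_ofReal ?_
    simpa using (tendsto_pow_atTop_nhds_zero_of_lt_one hρ0.le hρ1).mul_const C
  have hμ : μH[s] S ≤ ENNReal.ofReal (C ^ s) := by
    refine (Measure.hausdorffMeasure_le_liminf_sum s S _ hlim t
      (Eventually.of_forall fun n u => hdiam n u) (Eventually.of_forall fun n x hx => ?_)).trans ?_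
    · exact mem_iUnion.2 ⟨fun k => ⟨_, hW x hx k⟩, hx, fun _ => rfl⟩
    · refine liminf_le_of_frequently_le' (h.mono fun n hn => ?_)
      have hcard : (Fintype.card (∀ k : Fin n, W k) : ENNReal) =
          ENNReal.ofReal (∏ k : Fin n, ((W k).card : ℝ)) := by
        rw [Fintype.card_pi, ← Nat.cast_prod, ENNReal.ofReal_natCast]
        simp only [Fintype.card_coe]
      have hP : (0 : ℝ) ≤ ∏ k : Fin n, ((W k).card : ℝ) :=
        Finset.prod_nonneg fun _ _ => by positivity
      generalize (∏ k : Fin n, ((W k).card : ℝ)) = P at hn hcard hP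
      have hρC : 0 ≤ ρ ^ n * C := by positivity
      have hreal : P * (ρ ^ n * C) ^ s ≤ C ^ s := by
        rw [Real.mul_rpow (by positivity) hC0, ← mul_assoc, ← Real.rpow_pow_comm hρ0.le]
        exact mul_le_of_le_one_left (by positivity) hn
      calc ∑ u, Metric.ediam (t n u) ^ s
          ≤ ∑ _u : (∀ k : Fin n, W k), ENNReal.ofReal (ρ ^ n * C) ^ s :=
            Finset.sum_le_sum fun u _ => ENNReal.rpow_le_rpow (hdiam n u) hs
        _ = ENNReal.ofReal (P * (ρ ^ n * C) ^ s) := by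
          rw [Finset.sum_const, Finset.card_univ, nsmul_eq_mul, hcard,
            ENNReal.ofReal_rpow_of_nonneg hρC hs, ENNReal.ofReal_mul hP]
        _ ≤ ENNReal.ofReal (C ^ s) := ENNReal.ofReal_le_ofReal hreal
  have hfin : μH[((Real.toNNReal s : NNReal) : ℝ)] S ≠ ⊤ := by
    rw [Real.coe_toNNReal _ hs]
    exact (hμ.trans_lt ENNReal.ofReal_lt_top).ne
  exact dimH_le_of_hausdorffMeasure_ne_top hfin

theorem exists_digit_sets (hc : IsDifferenceCoding A D K dig shift) {K₁ K₂ : Set E}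
    (h : K₁ + K₂ ⊆ K) {x₀ y₀ : E} (hx₀ : x₀ ∈ K₁) (hy₀ : y₀ ∈ K₂) (n : ℕ) :
    ∃ U V : Finset E, U.Nonempty ∧ V.Nonempty ∧ (∀ x ∈ K₁, dig (shift^[n] (x + y₀)) ∈ U) ∧
      (∀ y ∈ K₂, dig (shift^[n] (x₀ + y)) ∈ V) ∧ U.card + V.card ≤ D.card + 1 := by
  classical
  have hmem : ∀ x ∈ K₁, ∀ y ∈ K₂, x + y ∈ K := fun x hx y hy => h (add_mem_add hx hy)
  have hdig : ∀ x ∈ K₁, ∀ y ∈ K₂, dig (shift^[n] (x + y)) ∈ D := fun x hx y hy =>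
    hc.dig_mem _ (hc.iterate_mem (hmem x hx y hy) n)
  set U := D.filter fun b => ∃ x ∈ K₁, dig (shift^[n] (x + y₀)) = b with hU
  set V := D.filter fun b => ∃ y ∈ K₂, dig (shift^[n] (x₀ + y)) = b with hV
  have hUm : ∀ x ∈ K₁, dig (shift^[n] (x + y₀)) ∈ U := fun x hx =>
    Finset.mem_filter.2 ⟨hdig x hx y₀ hy₀, x, hx, rfl⟩
  have hVm : ∀ y ∈ K₂, dig (shift^[n] (x₀ + y)) ∈ V := fun y hy =>
    Finset.mem_filter.2 ⟨hdig x₀ hx₀ y hy, y, hy, rfl⟩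
  refine ⟨U, V, ⟨_, hUm x₀ hx₀⟩, ⟨_, hVm y₀ hy₀⟩, hUm, hVm, ?_⟩
  have hsub : U + V ⊆ D + {dig (shift^[n] (x₀ + y₀))} := by
    intro z hz
    obtain ⟨u, hu, v, hv, rfl⟩ := Finset.mem_add.1 hz
    obtain ⟨-, x, hx, rfl⟩ := Finset.mem_filter.1 hu
    obtain ⟨-, y, hy, rfl⟩ := Finset.mem_filter.1 hv
    refine Finset.mem_add.2 ⟨_, hdig x hx y hy, _, Finset.mem_singleton_self _, ?_⟩
    have := hc.dig_iterate_sub n (hmem x hx y hy) (hmem x hx y₀ hy₀) (hmem x₀ hx₀ y hy)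
      (hmem x₀ hx₀ y₀ hy₀) (by abel)
    rw [sub_eq_sub_iff_add_eq_add] at this
    rw [this, add_comm]
  have : IsAddTorsionFree E := .of_isTorsionFree ℝ E
  have h1 := cauchy_davenport_of_isAddTorsionFree (s := U) (t := V) ⟨_, hUm x₀ hx₀⟩ ⟨_, hVm y₀ hy₀⟩
  have h2 := Finset.card_le_card hsub
  rw [Finset.add_singleton, Finset.card_vadd_finset] at h2
  omega

theorem dimH_le_or_dimH_le [MeasurableSpace E] [BorelSpace E]
    (hc : IsDifferenceCoding A D K dig shift) {ρ : ℝ} (hρ0 : 0 < ρ) (hρ1 : ρ < 1)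
    (hA : ∀ x, ‖A x‖ = ρ * ‖x‖) (hKc : IsCompact K) {K₁ K₂ : Set E} (hK₁ : K₁.Nonempty)
    (hK₂ : K₂.Nonempty) (h : K₁ + K₂ ⊆ K) {γ : ℝ}
    (hγ : ∀ m ∈ Finset.Icc 1 D.card,
      Real.log m + Real.log ((D.card + 1 - m : ℕ) : ℝ) ≤ γ)
    {s t : ℝ} (hst : γ ≤ (s + t) * -Real.log ρ) :
    (0 ≤ s ∧ dimH K₁ ≤ ENNReal.ofReal s) ∨ (0 ≤ t ∧ dimH K₂ ≤ ENNReal.ofReal t) := by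
  obtain ⟨x₀, hx₀⟩ := hK₁
  obtain ⟨y₀, hy₀⟩ := hK₂
  choose U V hUne hVne hU hV hUV using hc.exists_digit_sets h hx₀ hy₀
  have hstep : ∀ k, ((U k).card * ρ ^ s) * ((V k).card * ρ ^ t) ≤ 1 := by
    intro k
    have hu := (hUne k).card_pos
    have hv := (hVne k).card_pos
    have huv := hUV k
    have hm := hγ (U k).card (Finset.mem_Icc.2 (by omega))
    have hle : Real.log (V k).card ≤ Real.log ((D.card + 1 - (U k).card : ℕ) : ℝ) :=
      Real.log_le_log (by exact_mod_cast hv) (by exact_mod_cast (by omega))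
    have hu' : (0 : ℝ) < (U k).card := by exact_mod_cast hu
    have hv' : (0 : ℝ) < (V k).card := by exact_mod_cast hv
    rw [← Real.exp_log hu', ← Real.exp_log hv', Real.rpow_def_of_pos hρ0,
      Real.rpow_def_of_pos hρ0, ← Real.exp_add, ← Real.exp_add, ← Real.exp_add,
      Real.exp_le_one_iff]
    linarith
  have hprod : ∀ n : ℕ, ((∏ k : Fin n, ((U k).card : ℝ)) * (ρ ^ s) ^ n ≤ 1) ∨
      ((∏ k : Fin n, ((V k).card : ℝ)) * (ρ ^ t) ^ n ≤ 1) := by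
    intro n
    by_contra! hcon
    refine (one_lt_mul_of_lt_of_le hcon.1 hcon.2.le).not_ge ?_
    have hpow : ∀ a : ℝ, a ^ n = ∏ _k : Fin n, a := fun a => by simp
    rw [hpow, hpow, ← Finset.prod_mul_distrib, ← Finset.prod_mul_distrib,
      ← Finset.prod_mul_distrib]
    exact Finset.prod_le_one (fun k _ => by positivity) fun k _ => hstep k
  have hfreq := frequently_or_distrib.1 (Eventually.of_forall (f := atTop) hprod).frequently
  refine hfreq.imp (fun hf => ?_) (fun hf => ?_)
  · rw [← (IsometryEquiv.addRight y₀).isometry.dimH_image K₁]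
    refine hc.dimH_le_of_frequently hρ0 hρ1 hA hKc ?_ hUne ?_ hf
    · rintro _ ⟨x, hx, rfl⟩
      exact h (add_mem_add hx hy₀)
    · rintro _ ⟨x, hx, rfl⟩ n
      exact hU n x hx
  · rw [← (IsometryEquiv.addLeft x₀).isometry.dimH_image K₂]
    refine hc.dimH_le_of_frequently hρ0 hρ1 hA hKc ?_ hVne ?_ hf
    · rintro _ ⟨y, hy, rfl⟩
      exact h (add_mem_add hx₀ hy)
    · rintro _ ⟨y, hy, rfl⟩ n
      exact hV n y hy

theorem dimH_add_dimH_le [MeasurableSpace E] [BorelSpace E]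
    (hc : IsDifferenceCoding A D K dig shift) {ρ : ℝ} (hρ0 : 0 < ρ) (hρ1 : ρ < 1)
    (hA : ∀ x, ‖A x‖ = ρ * ‖x‖) (hKc : IsCompact K) {K₁ K₂ : Set E} (hK₁ : K₁.Nonempty)
    (hK₂ : K₂.Nonempty) (h : K₁ + K₂ ⊆ K) {γ : ℝ} (hγ0 : 0 ≤ γ)
    (hγ : ∀ m ∈ Finset.Icc 1 D.card,
      Real.log m + Real.log ((D.card + 1 - m : ℕ) : ℝ) ≤ γ) :
    dimH K₁ + dimH K₂ ≤ ENNReal.ofReal (γ / -Real.log ρ) := by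
  have hlog : 0 < -Real.log ρ := neg_pos.2 (Real.log_neg hρ0 hρ1)
  set σ : ℝ := γ / -Real.log ρ with hσ
  have hσ0 : 0 ≤ σ := div_nonneg hγ0 hlog.le
  have key : ∀ s t : ℝ, σ ≤ s + t →
      (0 ≤ s ∧ dimH K₁ ≤ ENNReal.ofReal s) ∨ (0 ≤ t ∧ dimH K₂ ≤ ENNReal.ofReal t) :=
    fun s t hst => hc.dimH_le_or_dimH_le hρ0 hρ1 hA hKc hK₁ hK₂ h hγ ((div_le_iff₀ hlog).1 hst)
  have h1 : dimH K₁ ≠ ⊤ := by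
    rcases key (σ + 1) (-1) (by linarith) with h' | h'
    · exact (h'.2.trans_lt ENNReal.ofReal_lt_top).ne
    · linarith [h'.1]
  have h2 : dimH K₂ ≠ ⊤ := by
    rcases key (-1) (σ + 1) (by linarith) with h' | h'
    · linarith [h'.1]
    · exact (h'.2.trans_lt ENNReal.ofReal_lt_top).ne
  lift dimH K₁ to NNReal using h1 with a
  lift dimH K₂ to NNReal using h2 with b
  rw [← ENNReal.coe_add, ← ENNReal.ofReal_coe_nnreal]
  refine ENNReal.ofReal_le_ofReal ?_
  push_cast
  by_contra! hlt
  rcases key (a - (a + b - σ) / 2) (b - (a + b - σ) / 2) (by linarith) with ⟨h0, h'⟩ | ⟨h0, h'⟩ <;>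
  · rw [← ENNReal.ofReal_coe_nnreal, ENNReal.ofReal_le_ofReal_iff h0] at h'
    linarith

end IsDifferenceCoding

theorem log_add_log_lt_two_mul_log {N m : ℕ} (hN : 2 ≤ N) (hm : m ∈ Finset.Icc 1 N) :
    Real.log m + Real.log ((N + 1 - m : ℕ) : ℝ) < 2 * Real.log N := by
  obtain ⟨h1, h2⟩ := Finset.mem_Icc.1 hm
  obtain ⟨k, rfl⟩ := Nat.exists_eq_add_of_le h2
  rw [show m + k + 1 - m = k + 1 by omega]
  have hm0 : (0 : ℝ) < m := by exact_mod_cast h1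
  rw [← Real.log_mul hm0.ne' (by positivity), two_mul, ← Real.log_mul (by positivity)
    (by positivity)]
  refine Real.log_lt_log (by positivity) ?_
  exact_mod_cast (by nlinarith : m * (k + 1) < (m + k) * (m + k))

end SelfSimilarCoding

/-- **Theorem 1.1.** Let `K` be the homogeneous self-similar set generated by
`Φ = {x ↦ A x + b : b ∈ D}`, where `A = ρO` is a linear contracting similarity with
ratio `ρ ∈ (0,1)` (`O` orthogonal) and `D` is finite with `#D ≥ 2`. If the IFS
`Ψ = {x ↦ A x + t : t ∈ D − D}` (whose attractor is `K − K`) satisfies the strong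
separation condition, then there is a constant `β < dim_H K`, namely
`β = γ / (−2 log ρ)` with `γ = max{log m + log(#D + 1 − m) : 1 ≤ m ≤ #D}`, such that
any non-empty `K₁, K₂` with `K₁ + K₂ ⊆ K` satisfy `dim_H K₁ + dim_H K₂ ≤ 2β`. -/
theorem stmt3 (d : ℕ) (ρ : ℝ) (hρ0 : 0 < ρ) (hρ1 : ρ < 1)
    (A : EuclideanSpace ℝ (Fin d) →L[ℝ] EuclideanSpace ℝ (Fin d))
    (hA : ∀ x, ‖A x‖ = ρ * ‖x‖)
    (D : Finset (EuclideanSpace ℝ (Fin d))) (hD : 2 ≤ D.card)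
    (K : Set (EuclideanSpace ℝ (Fin d))) (hKc : IsCompact K) (hKne : K.Nonempty)
    (hK : K = ⋃ b ∈ D, (fun x => A x + b) '' K)
    (hSSC : ∀ t ∈ (D : Set (EuclideanSpace ℝ (Fin d))) - (D : Set (EuclideanSpace ℝ (Fin d))),
      ∀ t' ∈ (D : Set (EuclideanSpace ℝ (Fin d))) - (D : Set (EuclideanSpace ℝ (Fin d))),
      t ≠ t' → Disjoint ((fun x => A x + t) '' (K - K)) ((fun x => A x + t') '' (K - K))) :
    ∃ β : ℝ,
      β = sSup {y : ℝ | ∃ m ∈ Finset.Icc 1 D.card,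
            y = Real.log m + Real.log ((D.card + 1 - m : ℕ) : ℝ)} / (-(2 * Real.log ρ)) ∧
      ENNReal.ofReal β < dimH K ∧
      ∀ K₁ K₂ : Set (EuclideanSpace ℝ (Fin d)), K₁.Nonempty → K₂.Nonempty →
        K₁ + K₂ ⊆ K → dimH K₁ + dimH K₂ ≤ 2 * ENNReal.ofReal β := by
  set L : ℝ := -Real.log ρ with hL
  have hLpos : 0 < L := neg_pos.2 (Real.log_neg hρ0 hρ1)
  set Γ : Set ℝ := {y : ℝ | ∃ m ∈ Finset.Icc 1 D.card,
    y = Real.log m + Real.log ((D.card + 1 - m : ℕ) : ℝ)} with hΓ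
  have hΓfin : Γ.Finite := by
    refine ((Finset.Icc 1 D.card).finite_toSet.image
      fun m : ℕ => Real.log m + Real.log ((D.card + 1 - m : ℕ) : ℝ)).subset ?_
    rintro _ ⟨m, hm, rfl⟩
    exact ⟨m, hm, rfl⟩
  have hγ : ∀ m ∈ Finset.Icc 1 D.card,
      Real.log m + Real.log ((D.card + 1 - m : ℕ) : ℝ) ≤ sSup Γ :=
    fun m hm => le_csSup hΓfin.bddAbove ⟨m, hm, rfl⟩
  have hone : 1 ∈ Finset.Icc 1 D.card := Finset.mem_Icc.2 (by omega)
  have hγ0 : 0 ≤ sSup Γ :=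
    (add_nonneg (Real.log_natCast_nonneg _) (Real.log_natCast_nonneg _)).trans (hγ 1 hone)
  have hγlt : sSup Γ < 2 * Real.log D.card := by
    obtain ⟨m, hm, hmeq⟩ := Set.Nonempty.csSup_mem (s := Γ) ⟨_, 1, hone, rfl⟩ hΓfin
    rw [hmeq]
    exact log_add_log_lt_two_mul_log hD hm
  have hinj : Function.Injective A := by
    refine (injective_iff_map_eq_zero A).2 fun x hx => ?_
    have := hA x
    rw [hx, norm_zero, eq_comm, mul_eq_zero] at this
    exact norm_eq_zero.1 (this.resolve_left hρ0.ne')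
  obtain ⟨dig, shift, hc⟩ := exists_isDifferenceCoding hinj hK hSSC
  have hβ : sSup Γ / -(2 * Real.log ρ) = sSup Γ / L / 2 := by
    rw [div_div, hL]
    congr 1
    ring
  refine ⟨_, rfl, ?_, fun K₁ K₂ hK₁ hK₂ h => ?_⟩
  · refine lt_of_lt_of_le ?_ (hc.le_dimH hρ0 hρ1 hA hD hKc hKne)
    have hlogD : 0 < Real.log D.card := Real.log_pos (by exact_mod_cast hD)
    rw [hβ, ENNReal.ofReal_lt_ofReal_iff (div_pos hlogD hLpos), div_right_comm]
    exact div_lt_div_of_pos_right (by linarith) hLpos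
  · refine (hc.dimH_add_dimH_le hρ0 hρ1 hA hKc hK₁ hK₂ h hγ0 hγ).trans_eq ?_
    rw [← ENNReal.ofReal_ofNat 2, ← ENNReal.ofReal_mul zero_le_two, hβ]
    congr 1
    ring
end

section
/- Let K ⊂ ℝ^d be the homogeneous self-similar set generated by the IFS {f_b(x) = ρOx + b : b ∈ D} with D finite and #D = 2, and suppose the IFS {g_b(x) = ρOx + b : b ∈ D − D} satisfies the strong separation condition. Then for any two non-empty sets K₁, K₂ ⊂ ℝ^d with K₁ + K₂ ⊂ K, we have dim_H K₁ + dim_H K₂ ≤ dim_H K. -/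
open MeasureTheory Filter Topology
open scoped ENNReal NNReal

section Coding

variable {E : Type*} [NormedAddCommGroup E] [NormedSpace ℝ E]

/-- `dig x` is the first digit of `x ∈ K` for the maps `y ↦ A y + b i`, and `σ x` the point of `K`
coded by the remaining digits; differences of digits are determined by differences of points. -/
structure IsCoding (A : E →L[ℝ] E) (b : Fin 2 → E) (K : Set E) (dig : E → Fin 2) (σ : E → E) :
    Prop where
  shift_mem : ∀ x ∈ K, σ x ∈ K
  eq_apply : ∀ x ∈ K, x = A (σ x) + b (dig x)
  apply_mem : ∀ i, ∀ x ∈ K, A x + b i ∈ K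
  sub_eq_sub : ∀ i j k l, ∀ x ∈ K, ∀ x' ∈ K, ∀ y ∈ K, ∀ y' ∈ K,
    A (x - x') + (b i - b j) = A (y - y') + (b k - b l) → b i - b j = b k - b l
  injective : Function.Injective b

namespace IsCoding

variable {A : E →L[ℝ] E} {b : Fin 2 → E} {K : Set E} {dig : E → Fin 2} {σ : E → E} {ρ : ℝ}

theorem iterate_mem (h : IsCoding A b K dig σ) (n : ℕ) {x : E} (hx : x ∈ K) : σ^[n] x ∈ K := by
  induction n generalizing x with
  | zero => exact hx
  | succ n ih => exact ih (h.shift_mem x hx)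

theorem norm_sub_eq (h : IsCoding A b K dig σ) (hA : ∀ x, ‖A x‖ = ρ * ‖x‖) (n : ℕ) {x y : E}
    (hx : x ∈ K) (hy : y ∈ K) (hxy : ∀ i < n, dig (σ^[i] x) = dig (σ^[i] y)) :
    ‖x - y‖ = ρ ^ n * ‖σ^[n] x - σ^[n] y‖ := by
  induction n generalizing x y with
  | zero => simp
  | succ n ih =>
    have h0 : dig x = dig y := hxy 0 n.succ_pos
    have h1 : x - y = A (σ x - σ y) := by
      conv_lhs => rw [h.eq_apply x hx, h.eq_apply y hy, h0]
      rw [map_sub]; abel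
    rw [h1, hA, ih (h.shift_mem x hx) (h.shift_mem y hy)
      (fun i hi => hxy (i + 1) (Nat.succ_lt_succ hi)), pow_succ']
    simp only [Function.iterate_succ_apply]
    ring

theorem step_sub_eq_sub (h : IsCoding A b K dig σ) (hA : Function.Injective A)
    {x x' y y' : E} (hx : x ∈ K) (hx' : x' ∈ K) (hy : y ∈ K) (hy' : y' ∈ K)
    (heq : x - x' = y - y') :
    b (dig x) - b (dig x') = b (dig y) - b (dig y') ∧ σ x - σ x' = σ y - σ y' := by
  have key : A (σ x - σ x') + (b (dig x) - b (dig x')) =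
      A (σ y - σ y') + (b (dig y) - b (dig y')) := by
    calc _ = (A (σ x) + b (dig x)) - (A (σ x') + b (dig x')) := by rw [map_sub]; abel
      _ = (A (σ y) + b (dig y)) - (A (σ y') + b (dig y')) := by
        rw [← h.eq_apply x hx, ← h.eq_apply x' hx', ← h.eq_apply y hy, ← h.eq_apply y' hy', heq]
      _ = _ := by rw [map_sub]; abel
  have hdig := h.sub_eq_sub _ _ _ _ _ (h.shift_mem x hx) _ (h.shift_mem x' hx') _
    (h.shift_mem y hy) _ (h.shift_mem y' hy') key
  rw [hdig] at key
  exact ⟨hdig, hA (add_right_cancel key)⟩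

theorem digit_sub_eq_sub (h : IsCoding A b K dig σ) (hA : Function.Injective A) (n : ℕ)
    {x x' y y' : E} (hx : x ∈ K) (hx' : x' ∈ K) (hy : y ∈ K) (hy' : y' ∈ K)
    (heq : x - x' = y - y') :
    b (dig (σ^[n] x)) - b (dig (σ^[n] x')) = b (dig (σ^[n] y)) - b (dig (σ^[n] y')) := by
  have hstep := h.step_sub_eq_sub hA hx hx' hy hy' heq
  induction n generalizing x x' y y' with
  | zero => exact hstep.1
  | succ n ih =>
    have hs := hstep.2
    have m := h.shift_mem
    exact ih (m x hx) (m x' hx') (m y hy) (m y' hy') hs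
      (h.step_sub_eq_sub hA (m x hx) (m x' hx') (m y hy) (m y' hy') hs)

theorem digit_eq_of_sub_eq_sub (h : IsCoding A b K dig σ) {i j k l : Fin 2}
    (heq : b i - b j = b k - b l) (hij : i ≠ j) : i = k ∧ j = l := by
  have h01 : b 0 - b 1 ≠ 0 := sub_ne_zero.2 (h.injective.ne (by decide))
  have h10 : b 0 - b 1 ≠ b 1 - b 0 := by
    rw [← neg_sub (b 0) (b 1)]
    intro hn
    have h2 : (2 : ℝ) • (b 0 - b 1) = 0 := by
      rw [two_smul]
      exact eq_neg_iff_add_eq_zero.1 hn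
    exact h01 ((smul_eq_zero.1 h2).resolve_left two_ne_zero)
  have hb : b i - b j ≠ 0 := sub_ne_zero.2 (h.injective.ne hij)
  fin_cases i <;> fin_cases j <;> fin_cases k <;> fin_cases l <;> simp_all

theorem digit_eq_of_sub_eq_zero (h : IsCoding A b K dig σ) {i j k : Fin 2}
    (heq : b i - b j = b k - b k) : i = j :=
  h.injective (sub_eq_zero.1 (heq.trans (sub_self _)))

/-- If `K₁ + K₂ ⊆ K`, every digit of `x₁ + x₂` depends on only one of the two summands. -/
theorem digit_const_left_or_right (h : IsCoding A b K dig σ) (hA : Function.Injective A)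
    {K₁ K₂ : Set E} (hK : ∀ x ∈ K₁, ∀ y ∈ K₂, x + y ∈ K) (n : ℕ) :
    (∀ y ∈ K₂, ∀ x ∈ K₁, ∀ x' ∈ K₁, dig (σ^[n] (x + y)) = dig (σ^[n] (x' + y))) ∨
    (∀ x ∈ K₁, ∀ y ∈ K₂, ∀ y' ∈ K₂, dig (σ^[n] (x + y)) = dig (σ^[n] (x + y'))) := by
  by_contra! hcon
  obtain ⟨⟨y, hy, a, ha, a', ha', hne⟩, x, hx, z, hz, z', hz', hne'⟩ := hcon
  have const : ∀ w ∈ K₂, dig (σ^[n] (a + y)) = dig (σ^[n] (a + w)) := fun w hw =>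
    (h.digit_eq_of_sub_eq_sub (h.digit_sub_eq_sub hA n (hK a ha y hy) (hK a' ha' y hy)
      (hK a ha w hw) (hK a' ha' w hw) (by abel)) hne).1
  have hsub := h.digit_sub_eq_sub hA n (hK x hx z hz) (hK x hx z' hz') (hK a ha z hz)
    (hK a ha z' hz') (by abel)
  rw [← const z hz, ← const z' hz'] at hsub
  exact hne' (h.digit_eq_of_sub_eq_zero hsub)

theorem digit_shift_apply (h : IsCoding A b K dig σ) (hA : Function.Injective A) (i : Fin 2)
    {x : E} (hx : x ∈ K) : dig (A x + b i) = i ∧ σ (A x + b i) = x := by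
  have hm := h.apply_mem i x hx
  have heq := h.eq_apply _ hm
  have key : A (x - σ (A x + b i)) + (b i - b (dig (A x + b i))) = A (x - x) + (b i - b i) := by
    calc _ = (A x + b i) - (A (σ (A x + b i)) + b (dig (A x + b i))) := by rw [map_sub]; abel
      _ = _ := by rw [← heq]; simp
  have hd := h.digit_eq_of_sub_eq_zero
    (h.sub_eq_sub _ _ _ _ _ hx _ (h.shift_mem _ hm) _ hx _ hx key)
  rw [← hd] at heq
  exact ⟨hd.symm, (hA (add_right_cancel heq)).symm⟩

theorem exists_digits_eq (h : IsCoding A b K dig σ) (hA : Function.Injective A)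
    (hne : K.Nonempty) (n : ℕ) (w : ℕ → Fin 2) :
    ∃ x ∈ K, ∀ i < n, dig (σ^[i] x) = w i := by
  induction n generalizing w with
  | zero => exact hne.imp fun x hx => ⟨hx, by simp⟩
  | succ n ih =>
    obtain ⟨x, hx, hxw⟩ := ih fun i => w (i + 1)
    obtain ⟨h0, h1⟩ := h.digit_shift_apply hA (w 0) hx
    refine ⟨A x + b (w 0), h.apply_mem _ x hx, fun i hi => ?_⟩
    cases i with
    | zero => exact h0
    | succ i =>
      rw [Function.iterate_succ_apply, h1]
      exact hxw i (Nat.lt_of_succ_lt_succ hi)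

theorem exists_pos_le_norm_sub (h : IsCoding A b K dig σ) (hA : Function.Injective A)
    (hK : IsCompact K) (hne : K.Nonempty) :
    ∃ c > 0, ∀ x ∈ K, ∀ y ∈ K, dig x ≠ dig y → c ≤ ‖x - y‖ := by
  have hcont : Continuous fun p : E × E => ‖(A p.1 + b 0) - (A p.2 + b 1)‖ := by fun_prop
  obtain ⟨⟨u, v⟩, ⟨hu, hv⟩, hmin⟩ :=
    (hK.prod hK).exists_isMinOn (hne.prod hne) hcont.continuousOn
  refine ⟨‖(A u + b 0) - (A v + b 1)‖, norm_pos_iff.2 (sub_ne_zero.2 fun heq => ?_), ?_⟩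
  · have h0 := (h.digit_shift_apply hA 0 hu).1
    rw [heq, (h.digit_shift_apply hA 1 hv).1] at h0
    exact absurd h0 (by decide)
  · have key : ∀ x ∈ K, ∀ y ∈ K, dig x = 0 → dig y = 1 →
        ‖(A u + b 0) - (A v + b 1)‖ ≤ ‖x - y‖ := fun x hx y hy h0 h1 => by
      have hle := hmin (Set.mk_mem_prod (h.shift_mem x hx) (h.shift_mem y hy))
      simp only [Set.mem_ofPred_eq] at hle
      rwa [← h0, ← h1, ← h.eq_apply x hx, ← h.eq_apply y hy, h0, h1] at hle
    intro x hx y hy hxy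
    obtain h0 | h0 : dig x = 0 ∨ dig x = 1 := by omega
    · exact key x hx y hy h0 (by omega)
    · rw [norm_sub_rev x y]
      exact key y hy x hx (by omega) h0

/-- Reading digits in base two maps `K` onto the unit interval, and is Hölder of exponent `s`
when `ρ ^ s = 1 / 2`. -/
theorem le_dimH (h : IsCoding A b K dig σ) (hρ : 0 < ρ) (hA : ∀ x, ‖A x‖ = ρ * ‖x‖)
    (hinj : Function.Injective A) (hK : IsCompact K) (hne : K.Nonempty) {s : ℝ≥0} (hs : 0 < s)
    (hρs : ρ ^ (s : ℝ) = 2⁻¹) : (s : ℝ≥0∞) ≤ dimH K := by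
  obtain ⟨c, hc, hsep⟩ := h.exists_pos_le_norm_sub hinj hK hne
  set φ : E → ℝ := fun x => Real.ofDigits fun i => dig (σ^[i] x) with hφ
  have hpow : ∀ n : ℕ, (((2 : ℕ) : ℝ) ^ n)⁻¹ = (ρ ^ n) ^ (s : ℝ) := fun n => by
    rw [← Real.rpow_natCast ρ n, ← Real.rpow_mul hρ.le, mul_comm, Real.rpow_mul hρ.le, hρs,
      Real.rpow_natCast, inv_pow, Nat.cast_ofNat]
  have hold : ∀ x ∈ K, ∀ y ∈ K, |φ x - φ y| ≤ (c⁻¹) ^ (s : ℝ) * ‖x - y‖ ^ (s : ℝ) := by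
    intro x hx y hy
    by_cases hxy : ∃ n, dig (σ^[n] x) ≠ dig (σ^[n] y)
    · classical
      have hlt : ∀ i < Nat.find hxy, dig (σ^[i] x) = dig (σ^[i] y) := fun i hi =>
        not_not.1 (Nat.find_min hxy hi)
      refine (Real.abs_ofDigits_sub_ofDigits_le hlt).trans ?_
      rw [hpow, ← Real.mul_rpow (by positivity) (by positivity)]
      refine Real.rpow_le_rpow (by positivity) ?_ s.coe_nonneg
      rw [h.norm_sub_eq hA _ hx hy hlt, le_inv_mul_iff₀ hc, mul_comm]
      exact mul_le_mul_of_nonneg_left (hsep _ (h.iterate_mem _ hx) _ (h.iterate_mem _ hy)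
        (Nat.find_spec hxy)) (by positivity)
    · push Not at hxy
      have : φ x = φ y := by simp only [hφ, hxy]
      rw [this, sub_self, abs_zero]
      positivity
  have hH : HolderOnWith (c⁻¹.toNNReal ^ (s : ℝ)) s φ K := by
    intro x hx y hy
    rw [edist_nndist, edist_nndist, ← ENNReal.coe_rpow_of_nonneg _ s.coe_nonneg, ← ENNReal.coe_mul,
      ENNReal.coe_le_coe, ← NNReal.coe_le_coe]
    push_cast
    rw [Real.dist_eq, dist_eq_norm, Real.coe_toNNReal _ (inv_pos.2 hc).le]
    exact hold x hx y hy
  have hclosed : IsClosed (φ '' K) := (hK.image_of_continuousOn (hH.continuousOn hs)).isClosed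
  have hsub : Set.Ico (0 : ℝ) 1 ⊆ φ '' K := by
    intro v hv
    rw [← hclosed.closure_eq, Metric.mem_closure_iff]
    intro ε hε
    obtain ⟨n, hn⟩ := exists_pow_lt_of_lt_one hε (by norm_num : (2⁻¹ : ℝ) < 1)
    obtain ⟨x, hx, hxw⟩ := h.exists_digits_eq hinj hne n (Real.digits v 2)
    refine ⟨φ x, Set.mem_image_of_mem φ hx, lt_of_le_of_lt ?_ hn⟩
    rw [Real.dist_eq, ← Real.ofDigits_digits one_lt_two hv, inv_pow]
    exact_mod_cast Real.abs_ofDigits_sub_ofDigits_le fun i hi => (hxw i hi).symm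
  have h1 : (1 : ℝ≥0∞) ≤ dimH (φ '' K) := by
    rw [← Nat.cast_one, ← Module.finrank_self ℝ,
      ← Real.dimH_of_mem_nhds (Ico_mem_nhds (by norm_num : (0 : ℝ) < 2⁻¹)
        (by norm_num : (2⁻¹ : ℝ) < 1))]
    exact dimH_mono hsub
  have h2 := h1.trans (hH.dimH_image_le hs)
  rwa [ENNReal.le_div_iff_mul_le (by simp [hs.ne']) (by simp), one_mul] at h2

end IsCoding

end Coding

/-- A set whose points are determined up to `C * r ^ n` by those of their first `n` binary digits
that lie in `S` is covered by `2 ^ #(S ∩ [0, n))` sets of that diameter. -/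
theorem hausdorffMeasure_le_liminf_of_digits {X : Type*} [MetricSpace X] [MeasurableSpace X]
    [BorelSpace X] (Y : Set X) (code : X → ℕ → Fin 2) (S : Set ℕ) [DecidablePred (· ∈ S)]
    (C r : ℝ≥0) (hr : r < 1) (p : ℝ≥0)
    (hY : ∀ n, ∀ x ∈ Y, ∀ y ∈ Y, (∀ i < n, i ∈ S → code x i = code y i) →
      edist x y ≤ (C * r ^ n : ℝ≥0)) :
    μH[p] Y ≤ liminf (fun n =>
      (((2 ^ ((Finset.range n).filter (· ∈ S)).card * (C * r ^ n) ^ (p : ℝ) : ℝ≥0)) : ℝ≥0∞))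
      atTop := by
  have hlim : Tendsto (fun n : ℕ => ((C * r ^ n : ℝ≥0) : ℝ≥0∞)) atTop (𝓝 0) := by
    have h0 := (NNReal.tendsto_pow_atTop_nhds_zero_of_lt_one hr).const_mul C
    rw [mul_zero] at h0
    exact ENNReal.tendsto_coe.2 h0
  let t : ∀ n, ((Finset.range n).filter (· ∈ S) → Fin 2) → Set X := fun n w =>
    {x ∈ Y | ∀ i, code x i.1 = w i}
  have hdiam : ∀ n w, Metric.ediam (t n w) ≤ (C * r ^ n : ℝ≥0) := fun n w =>
    Metric.ediam_le fun x hx y hy => hY n x hx.1 y hy.1 fun i hi hiS =>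
      (hx.2 ⟨i, by simp [hi, hiS]⟩).trans (hy.2 ⟨i, by simp [hi, hiS]⟩).symm
  refine (Measure.hausdorffMeasure_le_liminf_sum p Y _ hlim t
    (Eventually.of_forall hdiam) (Eventually.of_forall fun n x hx => ?_)).trans ?_
  · exact Set.mem_iUnion.2 ⟨fun i => code x i, hx, fun i => rfl⟩
  · refine liminf_le_liminf (Eventually.of_forall fun n => ?_)
    refine (Finset.sum_le_card_nsmul _ _ _ fun w _ =>
      ENNReal.rpow_le_rpow (hdiam n w) p.coe_nonneg).trans_eq ?_
    rw [← ENNReal.coe_rpow_of_nonneg _ p.coe_nonneg]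
    simp

namespace IsCoding

variable {E : Type*} [NormedAddCommGroup E] [NormedSpace ℝ E]
  {A : E →L[ℝ] E} {b : Fin 2 → E} {K : Set E} {dig : E → Fin 2} {σ : E → E}

theorem add_le_of_lt_dimH (h : IsCoding A b K dig σ) {ρ : ℝ≥0} (hρ0 : 0 < ρ) (hρ : ρ < 1)
    (hA : ∀ x, ‖A x‖ = ρ * ‖x‖) (hinj : Function.Injective A) (hK : IsCompact K) {s : ℝ≥0}
    (hρs : ρ ^ (s : ℝ) = 2⁻¹) {K₁ K₂ : Set E} (hne₁ : K₁.Nonempty) (hne₂ : K₂.Nonempty)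
    (hadd : ∀ x ∈ K₁, ∀ y ∈ K₂, x + y ∈ K) {p q : ℝ≥0} (hp : p < dimH K₁) (hq : q < dimH K₂) :
    p + q ≤ s := by
  classical
  by_contra! hlt
  borelize E
  obtain ⟨x₀, hx₀⟩ := hne₁
  obtain ⟨y₀, hy₀⟩ := hne₂
  obtain ⟨C, hC⟩ : ∃ C : ℝ≥0, ∀ x ∈ K, ∀ y ∈ K, ‖x - y‖ ≤ C := by
    obtain ⟨C, hC⟩ := Metric.isBounded_iff.1 hK.isBounded
    exact ⟨C.toNNReal, fun x hx y hy =>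
      (dist_eq_norm x y ▸ hC hx hy).trans (Real.le_coe_toNNReal C)⟩
  have hcyl : ∀ n, ∀ x ∈ K, ∀ y ∈ K, (∀ i < n, dig (σ^[i] x) = dig (σ^[i] y)) →
      edist x y ≤ (C * ρ ^ n : ℝ≥0) := by
    intro n x hx y hy hxy
    rw [edist_nndist, ENNReal.coe_le_coe, ← NNReal.coe_le_coe, coe_nndist, dist_eq_norm,
      h.norm_sub_eq hA n hx hy hxy, mul_comm]
    push_cast
    exact mul_le_mul_of_nonneg_right (hC _ (h.iterate_mem n hx) _ (h.iterate_mem n hy))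
      (by positivity)
  let S : Set ℕ := {n | ¬ ∀ y ∈ K₂, ∀ x ∈ K₁, ∀ x' ∈ K₁,
    dig (σ^[n] (x + y)) = dig (σ^[n] (x' + y))}
  have h₁ := hausdorffMeasure_le_liminf_of_digits K₁ (fun x i => dig (σ^[i] (x + y₀))) S C ρ hρ p
    (fun n x hx x' hx' heq => by
      rw [← edist_add_right x x' y₀]
      refine hcyl n _ (hadd x hx y₀ hy₀) _ (hadd x' hx' y₀ hy₀) fun i hi => ?_
      by_cases hiS : i ∈ S
      · exact heq i hi hiS
      · exact not_not.1 hiS y₀ hy₀ x hx x' hx')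
  have h₂ := hausdorffMeasure_le_liminf_of_digits K₂ (fun y i => dig (σ^[i] (x₀ + y))) Sᶜ C ρ hρ q
    (fun n y hy y' hy' heq => by
      rw [← edist_add_left x₀ y y']
      refine hcyl n _ (hadd x₀ hx₀ y hy) _ (hadd x₀ hx₀ y' hy') fun i hi => ?_
      by_cases hiS : i ∈ S
      · exact (h.digit_const_left_or_right hinj hadd i).resolve_left hiS x₀ hx₀ y hy y' hy'
      · exact heq i hi hiS)
  rw [hausdorffMeasure_of_lt_dimH hp, top_le_iff] at h₁
  rw [hausdorffMeasure_of_lt_dimH hq, top_le_iff] at h₂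
  have e₁ := eventually_lt_of_lt_liminf (h₁ ▸ ENNReal.one_lt_top)
  have e₂ := eventually_lt_of_lt_liminf
    (h₂ ▸ (ENNReal.coe_lt_top : ((C ^ ((p : ℝ) + q) : ℝ≥0) : ℝ≥0∞) < ⊤))
  obtain ⟨n, hn₁, hn₂⟩ := (e₁.and e₂).exists
  rw [ENNReal.one_lt_coe_iff] at hn₁
  rw [ENNReal.coe_lt_coe] at hn₂
  have hcard : ((Finset.range n).filter (· ∈ S)).card +
      ((Finset.range n).filter (· ∈ Sᶜ)).card = n := by
    simpa using Finset.card_filter_add_card_filter_not (s := Finset.range n) (· ∈ S)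
  have hprod := hn₂.trans_le (le_mul_of_one_le_left' hn₁.le)
  rw [mul_mul_mul_comm, ← pow_add, hcard,
    ← NNReal.rpow_add_of_nonneg _ p.coe_nonneg q.coe_nonneg, NNReal.mul_rpow, mul_left_comm] at hprod
  have hle : 2 ^ n * (ρ ^ n) ^ ((p : ℝ) + q) ≤ 1 := by
    calc 2 ^ n * (ρ ^ n) ^ ((p : ℝ) + q) ≤ 2 ^ n * (ρ ^ n) ^ (s : ℝ) := by
          exact mul_le_mul_right (NNReal.rpow_le_rpow_of_exponent_ge (pow_pos hρ0 n)
            (pow_le_one₀ zero_le hρ.le) (by exact_mod_cast hlt.le)) _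
      _ = 1 := by
        rw [← NNReal.rpow_natCast ρ n, ← NNReal.rpow_mul, mul_comm (n : ℝ), NNReal.rpow_mul, hρs,
          NNReal.rpow_natCast, ← mul_pow, mul_inv_cancel₀ two_ne_zero, one_pow]
  exact absurd hprod (mul_le_of_le_one_right' hle).not_gt

end IsCoding

open Pointwise

/-- If `K` is the homogeneous self-similar set of `{x ↦ A x + b : b ∈ D}` with
`#D = 2` (`A = ρO` a contracting similarity), and the difference IFS
`{x ↦ A x + t : t ∈ D − D}` satisfies the strong separation condition on its
attractor `K − K`, then `dim_H K₁ + dim_H K₂ ≤ dim_H K` whenever `K₁ + K₂ ⊆ K`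
with `K₁, K₂` non-empty. -/
theorem stmt4 (d : ℕ) (ρ : ℝ) (hρ0 : 0 < ρ) (hρ1 : ρ < 1)
    (A : EuclideanSpace ℝ (Fin d) →L[ℝ] EuclideanSpace ℝ (Fin d))
    (hA : ∀ x, ‖A x‖ = ρ * ‖x‖)
    (D : Finset (EuclideanSpace ℝ (Fin d))) (hD : D.card = 2)
    (K : Set (EuclideanSpace ℝ (Fin d))) (hKc : IsCompact K) (hKne : K.Nonempty)
    (hK : K = ⋃ b ∈ D, (fun x => A x + b) '' K)
    (hSSC : ∀ t ∈ (D : Set (EuclideanSpace ℝ (Fin d))) - (D : Set (EuclideanSpace ℝ (Fin d))),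
      ∀ t' ∈ (D : Set (EuclideanSpace ℝ (Fin d))) - (D : Set (EuclideanSpace ℝ (Fin d))),
      t ≠ t' → Disjoint ((fun x => A x + t) '' (K - K)) ((fun x => A x + t') '' (K - K))) :
    ∀ K₁ K₂ : Set (EuclideanSpace ℝ (Fin d)), K₁.Nonempty → K₂.Nonempty →
      K₁ + K₂ ⊆ K → dimH K₁ + dimH K₂ ≤ dimH K := by
  intro K₁ K₂ hne₁ hne₂ hadd
  have hsum : ∀ x ∈ K₁, ∀ y ∈ K₂, x + y ∈ K := fun x hx y hy => hadd (Set.add_mem_add hx hy)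
  obtain ⟨x₀, hx₀⟩ := hne₁
  obtain ⟨y₀, hy₀⟩ := hne₂
  have hinj : Function.Injective A := by
    refine (injective_iff_map_eq_zero A).2 fun x hx => ?_
    have hx' := hA x
    rw [hx, norm_zero] at hx'
    simpa [hρ0.ne'] using hx'.symm
  obtain ⟨b₀, b₁, hne, rfl⟩ := Finset.card_eq_two.1 hD
  set b : Fin 2 → EuclideanSpace ℝ (Fin d) := ![b₀, b₁] with hb
  have hbD : ∀ i, b i ∈ (({b₀, b₁} : Finset _) : Set (EuclideanSpace ℝ (Fin d))) := fun i => by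
    fin_cases i <;> simp [hb]
  have hmem : ∀ x ∈ K, ∃ y ∈ K, ∃ i, x = A y + b i := fun x hx => by
    rw [hK] at hx
    simp only [Finset.mem_insert, Finset.mem_singleton, Set.mem_iUnion, Set.mem_image] at hx
    obtain ⟨_, rfl | rfl, y, hy, rfl⟩ := hx
    · exact ⟨y, hy, 0, rfl⟩
    · exact ⟨y, hy, 1, rfl⟩
  choose! σ hσ dig hdig using hmem
  have hcode : IsCoding A b K dig σ :=
    { shift_mem := hσ
      eq_apply := hdig
      apply_mem := fun i x hx => by
        rw [hK]
        exact Set.mem_biUnion (hbD i) (Set.mem_image_of_mem _ hx)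
      sub_eq_sub := fun i j k l x hx x' hx' y hy y' hy' heq => by
        by_contra hcon
        refine Set.disjoint_left.1 (hSSC _ (Set.sub_mem_sub (hbD i) (hbD j)) _
          (Set.sub_mem_sub (hbD k) (hbD l)) hcon)
          (Set.mem_image_of_mem _ (Set.sub_mem_sub hx hx')) ?_
        exact ⟨y - y', Set.sub_mem_sub hy hy', heq.symm⟩
      injective := fun i j hij => by
        fin_cases i <;> fin_cases j
        · rfl
        · exact absurd hij hne
        · exact absurd hij.symm hne
        · rfl }
  lift ρ to ℝ≥0 using hρ0.le
  obtain ⟨s, hs0, hs⟩ : ∃ s : ℝ≥0, 0 < s ∧ ρ ^ (s : ℝ) = 2⁻¹ := by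
    have hlog : 0 < Real.logb ρ 2⁻¹ :=
      Real.logb_pos_of_base_lt_one hρ0 hρ1 (by norm_num) (by norm_num)
    refine ⟨⟨_, hlog.le⟩, hlog, NNReal.eq ?_⟩
    rw [NNReal.coe_rpow]
    exact (Real.rpow_logb hρ0 hρ1.ne (by norm_num)).trans (by simp)
  by_cases h₁ : dimH K₁ = 0
  · rw [h₁, zero_add, ← (isometry_add_left x₀).dimH_image]
    exact dimH_mono (Set.image_subset_iff.2 fun y hy => hsum x₀ hx₀ y hy)
  by_cases h₂ : dimH K₂ = 0
  · rw [h₂, add_zero, ← (isometry_add_right y₀).dimH_image]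
    exact dimH_mono (Set.image_subset_iff.2 fun x hx => hsum x hx y₀ hy₀)
  refine le_trans ?_ (hcode.le_dimH hρ0 hA hinj hKc hKne hs0
    (by simpa using congrArg NNReal.toReal hs))
  by_contra! hlt
  obtain ⟨p, hp, q, hq, hpq⟩ := ENNReal.exists_lt_add_of_lt_add hlt h₁ h₂
  lift p to ℝ≥0 using hp.ne_top
  lift q to ℝ≥0 using hq.ne_top
  exact hpq.not_ge (by exact_mod_cast
    hcode.add_le_of_lt_dimH hρ0 hρ1 hA hinj hKc hs ⟨x₀, hx₀⟩ ⟨y₀, hy₀⟩ hsum hp hq)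
end

section
/- Every self-similar set in ℝ (containing at least two points) has the positive dimension sumset property: for every ℓ ≥ 2 there exist compact sets K₁, …, K_ℓ with K₁ + ⋯ + K_ℓ ⊂ K and dim_H K_i > 0 for all i. -/
open Set Filter Topology
open scoped NNReal ENNReal

/-- A set parametrized by `F` has positive Hausdorff dimension if some Hölder function of `F`
covers the unit interval. -/
theorem dimH_range_pos_of_holder {Ω : Type*} {F G : Ω → ℝ} {C s : ℝ} (hC : 0 ≤ C) (hs : 0 < s)
    (hG : Icc 0 1 ⊆ range G) (h : ∀ x y, |G x - G y| ≤ C * |F x - F y| ^ s) :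
    0 < dimH (range F) := by
  rcases isEmpty_or_nonempty Ω with hΩ | hΩ
  · have := hG (left_mem_Icc.2 zero_le_one)
    simp at this
  have hle (x y : Ω) : edist (G x) (G y) ≤ ENNReal.ofReal C * edist (F x) (F y) ^ s := by
    rw [edist_dist, edist_dist, ENNReal.ofReal_rpow_of_nonneg dist_nonneg hs.le,
      ← ENNReal.ofReal_mul hC]
    exact ENNReal.ofReal_le_ofReal (h x y)
  have hFG (x : Ω) : G (F.invFun (F x)) = G x := by
    have hx : F (F.invFun (F x)) = F x := Function.invFun_eq ⟨x, rfl⟩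
    have := h (F.invFun (F x)) x
    rw [hx, sub_self, abs_zero, Real.zero_rpow hs.ne', mul_zero] at this
    exact sub_eq_zero.1 (abs_nonpos_iff.1 this)
  have hol : HolderOnWith C.toNNReal s.toNNReal (fun x => G (F.invFun x)) (range F) := by
    rintro _ ⟨x, rfl⟩ _ ⟨y, rfl⟩
    simp only [hFG, Real.coe_toNNReal s hs.le]
    exact hle x y
  have himage : Icc (0 : ℝ) 1 ⊆ (fun x => G (F.invFun x)) '' range F := by
    intro y hy
    obtain ⟨x, rfl⟩ := hG hy
    exact ⟨F x, ⟨x, rfl⟩, hFG x⟩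
  have hI : dimH (Icc (0 : ℝ) 1) = 1 := by
    simpa using Real.dimH_of_nonempty_interior (s := Icc (0 : ℝ) 1) (by simp)
  have hdim := (dimH_mono himage).trans (hol.dimH_image_le (Real.toNNReal_pos.2 hs))
  rw [hI] at hdim
  refine pos_iff_ne_zero.2 fun h0 => ?_
  simp [h0] at hdim

/-- The sum `∑ qᵏ (t + d ωₖ)` attached to a binary sequence `ω`. -/
noncomputable def cantorSum (q t d : ℝ) (ω : ℕ → Fin 2) : ℝ :=
  ∑' k, q ^ k * (t + d * ((ω k : ℕ) : ℝ))

theorem norm_cantorSum_term_le (q t d : ℝ) (ω : ℕ → Fin 2) (k : ℕ) :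
    ‖q ^ k * (t + d * ((ω k : ℕ) : ℝ))‖ ≤ |q| ^ k * (|t| + |d|) := by
  have h1 : |((ω k : ℕ) : ℝ)| ≤ 1 := by
    rw [Nat.abs_cast]
    exact_mod_cast Nat.lt_succ_iff.1 (ω k).2
  rw [Real.norm_eq_abs, abs_mul, abs_pow]
  gcongr
  refine (abs_add_le _ _).trans ?_
  rw [abs_mul]
  gcongr
  exact mul_le_of_le_one_right (abs_nonneg d) h1

theorem summable_cantorSum_bound {q : ℝ} (hq : |q| < 1) (M : ℝ) :
    Summable fun k : ℕ => |q| ^ k * M :=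
  (summable_geometric_of_lt_one (abs_nonneg q) hq).mul_right M

theorem summable_cantorSum {q : ℝ} (hq : |q| < 1) (t d : ℝ) (ω : ℕ → Fin 2) :
    Summable fun k => q ^ k * (t + d * ((ω k : ℕ) : ℝ)) :=
  (summable_cantorSum_bound hq _).of_norm_bounded (norm_cantorSum_term_le q t d ω)

theorem continuous_cantorSum {q : ℝ} (hq : |q| < 1) (t d : ℝ) :
    Continuous (cantorSum q t d) :=
  continuous_tsum (fun k => by fun_prop) (summable_cantorSum_bound hq _)
    fun k ω => norm_cantorSum_term_le q t d ω k

theorem isCompact_range_cantorSum {q : ℝ} (hq : |q| < 1) (t d : ℝ) :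
    IsCompact (range (cantorSum q t d)) :=
  isCompact_range (continuous_cantorSum hq t d)

/-- Binary sequences first differing at index `n` have sums at distance at least `|q|ⁿ |d| / 2`. -/
theorem le_abs_cantorSum_sub {q : ℝ} (hq : |q| ≤ 1 / 4) (t d : ℝ) {x y : ℕ → Fin 2} {n : ℕ}
    (hlt : ∀ i < n, x i = y i) (hn : x n ≠ y n) :
    |q| ^ n * |d| / 2 ≤ |cantorSum q t d x - cantorSum q t d y| := by
  have hq1 : |q| < 1 := by linarith
  have hsum : cantorSum q t d x - cantorSum q t d y =
      ∑' k, q ^ k * (d * (((x k : ℕ) : ℝ) - ((y k : ℕ) : ℝ))) := by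
    rw [cantorSum, cantorSum,
      ← (summable_cantorSum hq1 t d x).tsum_sub (summable_cantorSum hq1 t d y)]
    exact tsum_congr fun k => by ring
  have hsummable : Summable fun k => q ^ k * (d * (((x k : ℕ) : ℝ) - ((y k : ℕ) : ℝ))) :=
    ((summable_cantorSum hq1 t d x).sub (summable_cantorSum hq1 t d y)).congr fun k => by ring
  have hdigit (k : ℕ) : |((x k : ℕ) : ℝ) - ((y k : ℕ) : ℝ)| ≤ 1 := by
    generalize x k = u, y k = v
    fin_cases u <;> fin_cases v <;> simp
  have hdigit_n : |((x n : ℕ) : ℝ) - ((y n : ℕ) : ℝ)| = 1 := by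
    revert hn
    generalize x n = u, y n = v
    fin_cases u <;> fin_cases v <;> simp
  have hhead : ∑ k ∈ Finset.range (n + 1), q ^ k * (d * (((x k : ℕ) : ℝ) - ((y k : ℕ) : ℝ))) =
      q ^ n * (d * (((x n : ℕ) : ℝ) - ((y n : ℕ) : ℝ))) := by
    rw [Finset.sum_range_succ, Finset.sum_eq_zero, zero_add]
    intro k hk
    simp [hlt k (Finset.mem_range.1 hk)]
  have htail : |∑' k, q ^ (k + (n + 1)) *
      (d * (((x (k + (n + 1)) : ℕ) : ℝ) - ((y (k + (n + 1)) : ℕ) : ℝ)))| ≤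
      |q| ^ (n + 1) * |d| * (1 - |q|)⁻¹ := by
    rw [← Real.norm_eq_abs]
    refine tsum_of_norm_bounded
      ((hasSum_geometric_of_lt_one (abs_nonneg q) hq1).mul_left (|q| ^ (n + 1) * |d|)) fun k => ?_
    rw [Real.norm_eq_abs, abs_mul, abs_mul, abs_pow]
    calc _ ≤ |q| ^ (k + (n + 1)) * (|d| * 1) := by gcongr; exact hdigit _
      _ = _ := by ring
  have hinv : |q| * (1 - |q|)⁻¹ ≤ 1 / 2 := by
    rw [← div_eq_mul_inv, div_le_iff₀ (by linarith)]
    linarith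
  have htail' : |q| ^ (n + 1) * |d| * (1 - |q|)⁻¹ ≤ |q| ^ n * |d| / 2 := by
    calc _ = |q| ^ n * |d| * (|q| * (1 - |q|)⁻¹) := by ring
      _ ≤ |q| ^ n * |d| * (1 / 2) := by gcongr
      _ = _ := by ring
  rw [hsum, ← hsummable.sum_add_tsum_nat_add (n + 1), hhead]
  set T := ∑' k, q ^ (k + (n + 1)) *
      (d * (((x (k + (n + 1)) : ℕ) : ℝ) - ((y (k + (n + 1)) : ℕ) : ℝ)))
  have habs : |q ^ n * (d * (((x n : ℕ) : ℝ) - ((y n : ℕ) : ℝ)))| = |q| ^ n * |d| := by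
    rw [abs_mul, abs_mul, hdigit_n, abs_pow, mul_one]
  have := abs_sub_abs_le_abs_sub (q ^ n * (d * (((x n : ℕ) : ℝ) - ((y n : ℕ) : ℝ)))) (-T)
  rw [abs_neg, sub_neg_eq_add] at this
  linarith

theorem dimH_range_cantorSum_pos {q t d : ℝ} (hq0 : 0 < |q|) (hq : |q| ≤ 1 / 4) (hd : d ≠ 0) :
    0 < dimH (range (cantorSum q t d)) := by
  have hd' : 0 < |d| := abs_pos.2 hd
  have hq1 : |q| < 1 := by linarith
  set s := Real.logb |q| (1 / 2)
  have hs : 0 < s := Real.logb_pos_of_base_lt_one hq0 hq1 (by norm_num) (by norm_num)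
  have hqs : |q| ^ s = 1 / 2 := Real.rpow_logb hq0 hq1.ne (by norm_num)
  refine dimH_range_pos_of_holder (G := Real.ofDigits (b := 2)) (C := (2 / |d|) ^ s) (by positivity)
    hs ?_ fun x y => ?_
  · rw [← image_univ]
    exact Real.ofDigits_SurjOn one_lt_two
  rcases eq_or_ne x y with rfl | hxy
  · simp [Real.zero_rpow hs.ne']
  have hlt : ∀ i < PiNat.firstDiff x y, x i = y i := fun i hi => PiNat.apply_eq_of_lt_firstDiff hi
  have hdist := le_abs_cantorSum_sub hq t d hlt (PiNat.apply_firstDiff_ne hxy)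
  set n := PiNat.firstDiff x y
  calc |Real.ofDigits x - Real.ofDigits y| ≤ (((2 : ℕ) : ℝ) ^ n)⁻¹ :=
        Real.abs_ofDigits_sub_ofDigits_le hlt
    _ = (|q| ^ s) ^ n := by rw [hqs]; simp
    _ = (|q| ^ n) ^ s := by
        rw [← Real.rpow_natCast, ← Real.rpow_natCast, ← Real.rpow_mul hq0.le,
          ← Real.rpow_mul hq0.le, mul_comm]
    _ ≤ (2 / |d| * |cantorSum q t d x - cantorSum q t d y|) ^ s := by
        gcongr
        calc |q| ^ n = 2 / |d| * (|q| ^ n * |d| / 2) := by field_simp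
          _ ≤ _ := by gcongr
    _ = _ := Real.mul_rpow (by positivity) (abs_nonneg _)

/-- A set stable under each map `x ↦ r * x + w k` is stable under their compositions. -/
theorem sum_pow_mul_add_mem {K : Set ℝ} {r : ℝ} {w : ℕ → ℝ} (h : ∀ k, ∀ x ∈ K, r * x + w k ∈ K)
    (n : ℕ) : ∀ x ∈ K, ∑ k ∈ Finset.range n, r ^ k * w k + r ^ n * x ∈ K := by
  induction n with
  | zero => simp
  | succ n ih =>
    intro x hx
    convert ih _ (h n x hx) using 1
    rw [Finset.sum_range_succ]
    ring

theorem tsum_pow_mul_mem {K : Set ℝ} (hKc : IsClosed K) (hKn : K.Nonempty) {r : ℝ} (hr : |r| < 1)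
    {w : ℕ → ℝ} (hw : Summable fun k => r ^ k * w k) (h : ∀ k, ∀ x ∈ K, r * x + w k ∈ K) :
    ∑' k, r ^ k * w k ∈ K := by
  obtain ⟨x, hx⟩ := hKn
  have hlim : Tendsto (fun n => ∑ k ∈ Finset.range n, r ^ k * w k + r ^ n * x) atTop
      (𝓝 (∑' k, r ^ k * w k + 0 * x)) :=
    hw.hasSum.tendsto_sum_nat.add ((tendsto_pow_atTop_nhds_zero_of_abs_lt_one hr).mul_const x)
  rw [zero_mul, add_zero] at hlim
  exact hKc.mem_of_tendsto hlim (Eventually.of_forall fun n => sum_pow_mul_add_mem h n x hx)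

/-- If a compact set is covered by its images under contractions with a common fixed point, it has
at most one point; so two of the maps of the system do not commute. -/
theorem exists_not_commute {ι : Type*} {a c : ι → ℝ} (ha : ∀ j, |a j| < 1) {K : Set ℝ}
    (hKc : IsCompact K) (hKnt : K.Nontrivial) (hK : K ⊆ ⋃ j, (fun x => a j * x + c j) '' K) :
    ∃ i j, a i * c j + c i ≠ a j * c i + c j := by
  by_contra! hcomm
  obtain ⟨x₀, hx₀⟩ := hKnt.nonempty
  obtain ⟨i, -⟩ := mem_iUnion.1 (hK hx₀)
  have hne (j : ι) : 1 - a j ≠ 0 := by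
    have := (abs_lt.1 (ha j)).2
    linarith
  set p := c i / (1 - a i) with hp_def
  have hp : ∀ j, a j * p + c j = p := by
    intro j
    have := hcomm i j
    have hi := hne i
    rw [hp_def]
    field_simp
    linarith
  obtain ⟨z, hz, hmax⟩ := hKc.exists_isMaxOn ⟨x₀, hx₀⟩
    (f := fun x => |x - p|) (by fun_prop)
  obtain ⟨j, y, hy, hyz⟩ := mem_iUnion.1 (hK hz)
  simp only at hyz
  have hzp : |z - p| = |a j| * |y - p| := by
    rw [← abs_mul, ← hyz]
    congr 1
    linear_combination hp j
  have hyle : |y - p| ≤ |z - p| := hmax hy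
  have hz0 : |z - p| ≤ 0 := by
    nlinarith [ha j, abs_nonneg (a j), abs_nonneg (y - p)]
  have hall : ∀ x ∈ K, x = p := fun x hx =>
    sub_eq_zero.1 (abs_nonpos_iff.1 ((show |x - p| ≤ |z - p| from hmax hx).trans hz0))
  obtain ⟨u, hu, v, hv, huv⟩ := hKnt
  exact huv ((hall u hu).trans (hall v hv).symm)

/-- A nontrivial self-similar set on the line is stable under two distinct similarities with the
same, arbitrarily small, linear part. -/
theorem exists_equal_ratio_maps {ι : Type*} {a c : ι → ℝ} (ha : ∀ j, 0 < |a j| ∧ |a j| < 1)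
    {K : Set ℝ} (hKc : IsCompact K) (hKnt : K.Nontrivial)
    (hK : K = ⋃ j, (fun x => a j * x + c j) '' K) {ε : ℝ} (hε : 0 < ε) :
    ∃ r t d : ℝ, 0 < |r| ∧ |r| < ε ∧ d ≠ 0 ∧ ∀ x ∈ K, r * x + t ∈ K ∧ r * x + (t + d) ∈ K := by
  have hmem (j : ι) : ∀ x ∈ K, a j * x + c j ∈ K := by
    intro x hx
    rw [hK]
    exact mem_iUnion.2 ⟨j, x, hx, rfl⟩
  obtain ⟨i, j, hij⟩ := exists_not_commute (fun j => (ha j).2) hKc hKnt hK.le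
  obtain ⟨N, hN⟩ := exists_pow_lt_of_lt_one hε (ha i).2
  have hai : a i ≠ 0 := abs_pos.1 (ha i).1
  have haj : a j ≠ 0 := abs_pos.1 (ha j).1
  have hiter := sum_pow_mul_add_mem (r := a i) (w := fun _ => c i) (fun _ => hmem i) N
  set u := ∑ k ∈ Finset.range N, a i ^ k * c i
  refine ⟨a i ^ N * (a i * a j), u + a i ^ N * (a i * c j + c i),
    a i ^ N * ((a j * c i + c j) - (a i * c j + c i)), ?_, ?_, ?_, fun x hx => ⟨?_, ?_⟩⟩
  · positivity
  · rw [abs_mul, abs_mul, abs_pow]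
    refine lt_of_le_of_lt ?_ hN
    exact mul_le_of_le_one_right (by positivity)
      (mul_le_one₀ (ha i).2.le (abs_nonneg _) (ha j).2.le)
  · exact mul_ne_zero (pow_ne_zero N hai) (sub_ne_zero.2 hij.symm)
  · convert hiter _ (hmem i _ (hmem j x hx)) using 1
    ring
  · convert hiter _ (hmem j _ (hmem i x hx)) using 1
    ring

/-- **Theorem 1.3 (case of ℝ).** Every self-similar set `K ⊆ ℝ` (attractor of an
IFS of contracting similarities `f j x = a j * x + c j`, `0 < |a j| < 1`)
containing at least two points has the positive dimension sumset property: for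
every `ℓ ≥ 2` there exist compact sets `K₁, …, K_ℓ` with `K₁ + ⋯ + K_ℓ ⊆ K` and
`dim_H Kᵢ > 0` for all `i`. -/
theorem stmt14 (m : ℕ) (a c : Fin (m + 1) → ℝ) (ha : ∀ j, 0 < |a j| ∧ |a j| < 1)
    (K : Set ℝ) (hKc : IsCompact K) (hKnt : K.Nontrivial)
    (hK : K = ⋃ j, (fun x => a j * x + c j) '' K) :
    ∀ ℓ : ℕ, 2 ≤ ℓ → ∃ Ks : Fin ℓ → Set ℝ,
      (∀ i, IsCompact (Ks i)) ∧
      {x | ∃ f : Fin ℓ → ℝ, (∀ i, f i ∈ Ks i) ∧ x = ∑ i, f i} ⊆ K ∧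
      ∀ i, 0 < dimH (Ks i) := by
  intro ℓ hℓ
  obtain ⟨r, t, d, hr0, hr4, hd, hmem⟩ :=
    exists_equal_ratio_maps ha hKc hKnt hK (ε := 1 / 4) (by norm_num)
  have hr1 : |r| ≤ 1 := by linarith
  have hq0 : 0 < |r ^ ℓ| := by
    rw [abs_pow]
    positivity
  have hq4 : |r ^ ℓ| ≤ 1 / 4 := by
    rw [abs_pow]
    exact (pow_le_of_le_one (abs_nonneg r) hr1 (by lia)).trans hr4.le
  have hq1 : |r ^ ℓ| < 1 := by linarith
  refine ⟨fun i => range (cantorSum (r ^ ℓ) (r ^ (i : ℕ) * t) (r ^ (i : ℕ) * d)),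
    fun i => isCompact_range_cantorSum hq1 _ _, ?_, fun i => dimH_range_cantorSum_pos hq0 hq4
      (mul_ne_zero (pow_ne_zero _ (abs_pos.1 hr0)) hd)⟩
  rintro x ⟨f, hf, rfl⟩
  choose ω hω using hf
  have hsummable (i : Fin ℓ) :=
    summable_cantorSum hq1 (r ^ (i : ℕ) * t) (r ^ (i : ℕ) * d) (ω i)
  have hdigit (v : Fin 2) : ∀ x ∈ K, r * x + (t + d * ((v : ℕ) : ℝ)) ∈ K := by
    intro x hx
    fin_cases v
    · simpa using (hmem x hx).1
    · simpa using (hmem x hx).2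
  have hblock (k : ℕ) : ∀ x ∈ K, r ^ ℓ * x + ∑ i : Fin ℓ,
      (r ^ (i : ℕ) * t + r ^ (i : ℕ) * d * ((ω i k : ℕ) : ℝ)) ∈ K := by
    intro x hx
    let v : ℕ → Fin 2 := fun n => if h : n < ℓ then ω ⟨n, h⟩ k else 0
    convert sum_pow_mul_add_mem (fun n => hdigit (v n)) ℓ x hx using 1
    rw [add_comm, ← Fin.sum_univ_eq_sum_range (fun n => r ^ n * (t + d * ((v n : ℕ) : ℝ)))]
    congr 1
    refine Finset.sum_congr rfl fun i _ => ?_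
    simp only [v, i.2, dif_pos]
    ring
  have htsum : ∑ i, f i = ∑' k, (r ^ ℓ) ^ k * ∑ i : Fin ℓ,
      (r ^ (i : ℕ) * t + r ^ (i : ℕ) * d * ((ω i k : ℕ) : ℝ)) := by
    simp_rw [Finset.mul_sum]
    rw [Summable.tsum_finsetSum fun i _ => hsummable i]
    exact Finset.sum_congr rfl fun i _ => (hω i).symm
  rw [htsum]
  refine tsum_pow_mul_mem hKc.isClosed hKnt.nonempty hq1 ?_ hblock
  simp_rw [Finset.mul_sum]
  exact summable_sum fun i _ => hsummable i
end

section
/- For any integer N ≥ 1 and 0 < ρ < 1/(2N+1), the homogeneous self-similar set E_{ρ,N} = {((1−ρ)/N) Σ_{k=1}^∞ x_k ρ^{k−1} : x_k ∈ {0,1,…,N}} does not have the Hausdorff 2-sumset property: there is no pair of compact sets K₁, K₂ ⊂ ℝ with K₁ + K₂ ⊂ E_{ρ,N} and dim_H K₁ = dim_H K₂ = dim_H E_{ρ,N}. -/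
open Pointwise

open Filter Topology MeasureTheory NNReal ENNReal in
/-- A set whose points are determined up to `C * ρ ^ n` by the first `n` digits, the `k`-th digit
ranging over the finite set `A k`, has Hausdorff dimension at most `r` as soon as the number of
words of length `n` is at most `(ρ ^ n) ^ (-r)` for infinitely many `n`. -/
theorem dimH_le_of_frequently_card_mul_le {ρ C : ℝ} (hρ0 : 0 < ρ) (hρ1 : ρ < 1) (hC : 0 ≤ C)
    {K : Set ℝ} {p : ℝ → ℕ → ℕ} {A : ℕ → Finset ℕ} (hA : ∀ a ∈ K, ∀ k, p a k ∈ A k)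
    (hp : ∀ n, ∀ a ∈ K, ∀ a' ∈ K, (∀ k < n, p a k = p a' k) → dist a a' ≤ C * ρ ^ n)
    {r : ℝ≥0}
    (hr : ∃ᶠ n in atTop, (∏ k ∈ Finset.range n, ((A k).card : ℝ)) * (ρ ^ n) ^ (r : ℝ) ≤ 1) :
    dimH K ≤ r := by
  let l : Filter ℕ := atTop ⊓
    𝓟 {n | (∏ k ∈ Finset.range n, ((A k).card : ℝ)) * (ρ ^ n) ^ (r : ℝ) ≤ 1}
  have : l.NeBot := frequently_iff_neBot.mp hr
  let t : ∀ n : ℕ, (∀ k : Fin n, A k) → Set ℝ := fun n w => {a ∈ K | ∀ k : Fin n, p a k = w k}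
  have ht : ∀ n w, Metric.ediam (t n w) ≤ ENNReal.ofReal (C * ρ ^ n) := fun n w =>
    Metric.ediam_le_of_forall_dist_le fun a ha a' ha' =>
      hp n a ha.1 a' ha'.1 fun k hk => (ha.2 ⟨k, hk⟩).trans (ha'.2 ⟨k, hk⟩).symm
  have hlim : Tendsto (fun n : ℕ => ENNReal.ofReal (C * ρ ^ n)) l (𝓝 0) := by
    have := (tendsto_pow_atTop_nhds_zero_of_lt_one hρ0.le hρ1).const_mul C
    simpa using (ENNReal.tendsto_ofReal this).mono_left inf_le_left
  have hcov : ∀ n, K ⊆ ⋃ w, t n w := fun n a ha =>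
    Set.mem_iUnion.2 ⟨fun k => ⟨p a k, hA a ha k⟩, ha, fun _ => rfl⟩
  have hmain := Measure.hausdorffMeasure_le_liminf_sum (r : ℝ) K _ hlim t
    (Eventually.of_forall ht) (Eventually.of_forall hcov)
  refine dimH_le_of_hausdorffMeasure_ne_top
    (ne_top_of_le_ne_top (b := ENNReal.ofReal (C ^ (r : ℝ))) ENNReal.ofReal_ne_top
      (hmain.trans (liminf_le_of_frequently_le' ?_)))
  refine Eventually.frequently (eventually_inf_principal.2 (Eventually.of_forall fun n hn => ?_))
  calc ∑ w, Metric.ediam (t n w) ^ (r : ℝ)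
      ≤ ∑ _w : (∀ k : Fin n, A k), ENNReal.ofReal ((C * ρ ^ n) ^ (r : ℝ)) := by
        refine Finset.sum_le_sum fun w _ => ?_
        rw [← ENNReal.ofReal_rpow_of_nonneg (by positivity) r.coe_nonneg]
        exact ENNReal.rpow_le_rpow (ht n w) r.coe_nonneg
    _ = ENNReal.ofReal (C ^ (r : ℝ) *
          ((∏ k ∈ Finset.range n, ((A k).card : ℝ)) * (ρ ^ n) ^ (r : ℝ))) := by
        rw [Finset.sum_const, nsmul_eq_mul, Finset.card_univ, Fintype.card_pi,
          ← ENNReal.ofReal_natCast, ← ENNReal.ofReal_mul (by positivity),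
          Real.mul_rpow hC (by positivity)]
        simp only [Fintype.card_coe, Nat.cast_prod,
          Fin.prod_univ_eq_prod_range (fun k => ((A k).card : ℝ)) n]
        congr 1
        ring
    _ ≤ ENNReal.ofReal (C ^ (r : ℝ)) :=
        ENNReal.ofReal_le_ofReal (mul_le_of_le_one_right (by positivity) hn)

theorem summable_mul_pow_of_abs_le {ρ C : ℝ} (hρ0 : 0 < ρ) (hρ1 : ρ < 1) {e : ℕ → ℝ}
    (he : ∀ k, |e k| ≤ C) : Summable fun k => e k * ρ ^ k := by
  refine Summable.of_norm_bounded
    ((summable_geometric_of_lt_one hρ0.le hρ1).mul_left C) fun k => ?_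
  rw [Real.norm_eq_abs, abs_mul, abs_of_pos (pow_pos hρ0 k)]
  exact mul_le_mul_of_nonneg_right (he k) (by positivity)

theorem tsum_mul_pow_eq_of_eq_zero {ρ C : ℝ} (hρ0 : 0 < ρ) (hρ1 : ρ < 1) {e : ℕ → ℝ}
    (he : ∀ k, |e k| ≤ C) {n : ℕ} (hn : ∀ k < n, e k = 0) :
    ∑' k, e k * ρ ^ k = ρ ^ n * ∑' k, e (k + n) * ρ ^ k := by
  rw [← (summable_mul_pow_of_abs_le hρ0 hρ1 he).sum_add_tsum_nat_add n,
    Finset.sum_eq_zero fun k hk => by rw [hn k (Finset.mem_range.1 hk), zero_mul], zero_add,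
    ← tsum_mul_left]
  exact tsum_congr fun k => by ring

theorem abs_tsum_mul_pow_le {ρ C : ℝ} (hρ0 : 0 < ρ) (hρ1 : ρ < 1) {e : ℕ → ℝ}
    (he : ∀ k, |e k| ≤ C) {n : ℕ} (hn : ∀ k < n, e k = 0) :
    |∑' k, e k * ρ ^ k| ≤ ρ ^ n * (C / (1 - ρ)) := by
  rw [tsum_mul_pow_eq_of_eq_zero hρ0 hρ1 he hn, abs_mul, abs_of_pos (pow_pos hρ0 n)]
  gcongr
  rw [← Real.norm_eq_abs]
  refine tsum_of_norm_bounded (g := fun k => C * ρ ^ k) ?_ fun k => ?_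
  · rw [div_eq_mul_inv]
    exact (hasSum_geometric_of_lt_one hρ0.le hρ1).mul_left C
  · rw [Real.norm_eq_abs, abs_mul, abs_of_pos (pow_pos hρ0 k)]
    exact mul_le_mul_of_nonneg_right (he _) (by positivity)

theorem le_abs_tsum_intCast_mul_pow {ρ C : ℝ} (hρ0 : 0 < ρ) (hρ1 : ρ < 1) {e : ℕ → ℤ}
    (he : ∀ k, |(e k : ℝ)| ≤ C) {n : ℕ} (hn : ∀ k < n, e k = 0) (hne : e n ≠ 0) :
    ρ ^ n * (1 - ρ * (C / (1 - ρ))) ≤ |∑' k, (e k : ℝ) * ρ ^ k| := by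
  rw [tsum_mul_pow_eq_of_eq_zero hρ0 hρ1 he (n := n) fun k hk => by simp [hn k hk], abs_mul,
    abs_of_pos (pow_pos hρ0 n)]
  gcongr
  have hs := (summable_mul_pow_of_abs_le hρ0 hρ1 (e := fun k => (e (k + n) : ℝ)) fun k => he _)
  rw [hs.tsum_eq_zero_add]
  have htail : |∑' k, (e (k + 1 + n) : ℝ) * ρ ^ (k + 1)| ≤ ρ * (C / (1 - ρ)) := by
    have := abs_tsum_mul_pow_le hρ0 hρ1 (e := fun k => (e (k + 1 + n) : ℝ)) (fun k => he _)
      (n := 0) (by simp)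
    have heq : ∑' k, (e (k + 1 + n) : ℝ) * ρ ^ (k + 1)
        = ρ * ∑' k, (e (k + 1 + n) : ℝ) * ρ ^ k := by
      rw [← tsum_mul_left]
      exact tsum_congr fun k => by ring
    rw [heq, abs_mul, abs_of_pos hρ0]
    gcongr
    simpa using this
  have h1 : (1 : ℝ) ≤ |(e n : ℝ)| := by
    exact_mod_cast Int.one_le_abs hne
  have h2 := abs_sub_abs_le_abs_add (e n : ℝ) (∑' k, (e (k + 1 + n) : ℝ) * ρ ^ (k + 1))
  simp only [zero_add, pow_zero, mul_one]
  linarith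

theorem eq_zero_of_tsum_intCast_mul_pow_eq_zero {ρ C : ℝ} (hρ0 : 0 < ρ) (hρ1 : ρ < 1)
    (hC : ρ * (C / (1 - ρ)) < 1) {e : ℕ → ℤ} (he : ∀ k, |(e k : ℝ)| ≤ C)
    (h0 : ∑' k, (e k : ℝ) * ρ ^ k = 0) : ∀ k, e k = 0 := by
  by_contra! hne
  classical
  have hle := le_abs_tsum_intCast_mul_pow hρ0 hρ1 he
    (fun k hk => not_not.1 (Nat.find_min hne hk)) (Nat.find_spec hne)
  rw [h0, abs_zero] at hle
  have := mul_pos (pow_pos hρ0 (Nat.find hne)) (sub_pos.2 hC)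
  linarith

theorem pow_rpow_log_div_neg_log {ρ b : ℝ} (hρ0 : 0 < ρ) (hρ1 : ρ < 1) (hb : 0 < b) (n : ℕ) :
    (ρ ^ n) ^ (Real.log b / -Real.log ρ) = (b ^ n)⁻¹ := by
  have hlog : Real.log ρ ≠ 0 := (Real.log_neg hρ0 hρ1).ne
  rw [← Real.rpow_natCast, ← Real.rpow_mul hρ0.le, mul_comm, Real.rpow_mul hρ0.le,
    Real.rpow_natCast, ← inv_pow]
  congr 1
  rw [Real.rpow_def_of_pos hρ0, show Real.log ρ * (Real.log b / -Real.log ρ) = -Real.log b by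
    field_simp, Real.exp_neg, Real.exp_log hb]

open NNReal ENNReal in
/-- A set with a digit coding onto `ℕ → Fin b`, such that points whose codes differ before place
`n` are at least `c * ρ ^ n` apart, has Hausdorff dimension at least `log b / -log ρ`. -/
theorem le_dimH_of_digits {ρ c : ℝ} (hρ0 : 0 < ρ) (hρ1 : ρ < 1) (hc : 0 < c) {b : ℕ}
    (hb : 1 < b) {E : Set ℝ} {p : ℝ → ℕ → Fin b} (hsurj : Set.SurjOn p E Set.univ)
    (hp : ∀ n, ∀ x ∈ E, ∀ y ∈ E, (∀ k < n, p x k = p y k) → p x n ≠ p y n →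
      c * ρ ^ n ≤ dist x y)
    {s : ℝ≥0} (hs : (s : ℝ) = Real.log b / -Real.log ρ) : (s : ℝ≥0∞) ≤ dimH E := by
  have hb0 : (0 : ℝ) < b := by positivity
  have hs0 : 0 < s := by
    rw [← NNReal.coe_pos, hs]
    exact div_pos (Real.log_pos (by exact_mod_cast hb)) (neg_pos.2 (Real.log_neg hρ0 hρ1))
  let g : ℝ → ℝ := fun x => Real.ofDigits (p x)
  have hg : HolderOnWith ((c⁻¹ ^ (s : ℝ)).toNNReal) s g E := by
    intro x hx y hy
    by_cases hxy : p x = p y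
    · simp [g, hxy]
    have hne : ∃ n, p x n ≠ p y n := Function.ne_iff.1 hxy
    classical
    have hmin : ∀ k < Nat.find hne, p x k = p y k := fun k hk => not_not.1 (Nat.find_min hne hk)
    have h1 := hp _ x hx y hy hmin (Nat.find_spec hne)
    have h2 : dist (g x) (g y) ≤ c⁻¹ ^ (s : ℝ) * dist x y ^ (s : ℝ) := by
      calc dist (g x) (g y) ≤ ((b : ℝ) ^ Nat.find hne)⁻¹ :=
            Real.abs_ofDigits_sub_ofDigits_le hmin
        _ = (ρ ^ Nat.find hne) ^ (s : ℝ) := by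
            rw [hs, pow_rpow_log_div_neg_log hρ0 hρ1 hb0]
        _ ≤ (c⁻¹ * dist x y) ^ (s : ℝ) := by
            refine Real.rpow_le_rpow (by positivity) ?_ s.coe_nonneg
            rwa [inv_mul_eq_div, le_div_iff₀' hc]
        _ = _ := Real.mul_rpow (by positivity) dist_nonneg
    rw [edist_dist, edist_dist, ENNReal.ofReal_rpow_of_nonneg dist_nonneg s.coe_nonneg]
    change _ ≤ ENNReal.ofReal _ * _
    rw [← ENNReal.ofReal_mul (by positivity)]
    exact ENNReal.ofReal_le_ofReal h2
  have himg : Set.Ico (0 : ℝ) 1 ⊆ g '' E := by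
    intro t ht
    have : NeZero b := ⟨by omega⟩
    obtain ⟨x, hx, hpx⟩ := hsurj (Set.mem_univ (Real.digits t b))
    exact ⟨x, hx, by simp only [g, hpx, Real.ofDigits_digits hb ht]⟩
  have h1 : (1 : ℝ≥0∞) ≤ dimH E / s := by
    have hdim : dimH (Set.Ico (0 : ℝ) 1) = 1 := by
      rw [Real.dimH_of_nonempty_interior (by simp [interior_Ico])]
      simp
    calc (1 : ℝ≥0∞) = dimH (Set.Ico (0 : ℝ) 1) := hdim.symm
      _ ≤ dimH (g '' E) := dimH_mono himg
      _ ≤ dimH E / s := hg.dimH_image_le hs0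
  have := (ENNReal.le_div_iff_mul_le (Or.inl (by exact_mod_cast hs0.ne')) (by simp)).1 h1
  simpa using this

/-- For `N ≥ 1` and `0 < ρ < 1/(2N+1)`, the homogeneous self-similar set
`E_{ρ,N} = {((1−ρ)/N) ∑ₖ xₖ ρ^k : xₖ ∈ {0,…,N}}` fails the Hausdorff 2-sumset
property: there are no compact `K₁, K₂ ⊆ ℝ` with `K₁ + K₂ ⊆ E_{ρ,N}` and
`dim_H K₁ = dim_H K₂ = dim_H E_{ρ,N}`. -/
theorem stmt16 (N : ℕ) (hN : 1 ≤ N) (ρ : ℝ) (hρ0 : 0 < ρ)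
    (hρ1 : ρ < 1 / (2 * N + 1))
    (E : Set ℝ)
    (hE : E = {x | ∃ xx : ℕ → ℕ, (∀ k, xx k ≤ N) ∧
      x = (1 - ρ) / N * ∑' k : ℕ, (xx k : ℝ) * ρ ^ k}) :
    ¬ ∃ K₁ K₂ : Set ℝ, IsCompact K₁ ∧ IsCompact K₂ ∧ K₁ + K₂ ⊆ E ∧
      dimH K₁ = dimH E ∧ dimH K₂ = dimH E := by
  rintro ⟨K₁, K₂, -, -, hK, hd₁, hd₂⟩
  have hN' : (1 : ℝ) ≤ N := by exact_mod_cast hN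
  have hρN : ρ * (2 * N + 1) < 1 := (lt_div_iff₀ (by positivity)).1 hρ1
  have hρ1 : ρ < 1 := by nlinarith
  have hρ1' : 0 < 1 - ρ := by linarith
  have hsep : ρ * (2 * N / (1 - ρ)) < 1 := by
    rw [← mul_div_assoc, div_lt_one hρ1']
    linarith
  have hc : 0 < (1 - ρ) / N := by positivity
  have hcode : ∀ y : ℝ, ∃ xx : ℕ → ℕ, (∀ k, xx k ≤ N) ∧
      (y ∈ E → y = (1 - ρ) / N * ∑' k : ℕ, (xx k : ℝ) * ρ ^ k) := by
    intro y
    by_cases hy : y ∈ E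
    · rw [hE] at hy
      exact hy.imp fun xx h => ⟨h.1, fun _ => h.2⟩
    · exact ⟨0, by simp, fun h => absurd h hy⟩
  choose x hxN hx using hcode
  have hsum : ∀ xx : ℕ → ℕ, (∀ k, xx k ≤ N) → Summable fun k => (xx k : ℝ) * ρ ^ k :=
    fun xx h => summable_mul_pow_of_abs_le hρ0 hρ1 (C := N) fun k => by
      rw [Nat.abs_cast]; exact_mod_cast h k
  have hsub : ∀ xx yy : ℕ → ℕ, (∀ k, xx k ≤ N) → (∀ k, yy k ≤ N) →
      ∑' k, (((xx k : ℤ) - yy k : ℤ) : ℝ) * ρ ^ k =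
        ∑' k, (xx k : ℝ) * ρ ^ k - ∑' k, (yy k : ℝ) * ρ ^ k := fun xx yy h h' => by
    rw [← (hsum xx h).tsum_sub (hsum yy h')]
    exact tsum_congr fun k => by push_cast; ring
  have habs : ∀ xx yy : ℕ → ℕ, (∀ k, xx k ≤ N) → (∀ k, yy k ≤ N) → ∀ k,
      |(((xx k : ℤ) - yy k : ℤ) : ℝ)| ≤ N := fun xx yy h h' k => by
    have : |(xx k : ℤ) - yy k| ≤ N := by
      have := h k
      have := h' k
      rw [abs_le]
      omega
    exact_mod_cast this
  have hdist : ∀ y ∈ E, ∀ z ∈ E, dist y z =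
      (1 - ρ) / N * |∑' k, (((x y k : ℤ) - x z k : ℤ) : ℝ) * ρ ^ k| := fun y hy z hz => by
    rw [hsub _ _ (hxN y) (hxN z), ← abs_of_pos hc, ← abs_mul, mul_sub, ← hx y hy, ← hx z hz,
      Real.dist_eq]
  -- lower bound for the dimension of `E`
  let s : NNReal := (Real.log ((N + 1 : ℕ) : ℝ) / -Real.log ρ).toNNReal
  have hlogρ : 0 < -Real.log ρ := neg_pos.2 (Real.log_neg hρ0 hρ1)
  have hs : (s : ℝ) = Real.log ((N + 1 : ℕ) : ℝ) / -Real.log ρ :=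
    Real.coe_toNNReal _ (div_nonneg (Real.log_natCast_nonneg _) hlogρ.le)
  have hEs : (s : ENNReal) ≤ dimH E := by
    refine le_dimH_of_digits hρ0 hρ1
      (c := (1 - ρ) / N * (1 - ρ * (2 * N / (1 - ρ)))) (mul_pos hc (sub_pos.2 hsep))
      (b := N + 1) (by omega) (p := fun y k => ⟨x y k, Nat.lt_succ_of_le (hxN y k)⟩) ?_ ?_ hs
    · intro d _
      have hdN : ∀ k, ((d k : Fin (N + 1)) : ℕ) ≤ N := fun k => Nat.le_of_lt_succ (d k).2
      refine ⟨(1 - ρ) / N * ∑' k : ℕ, ((d k : ℕ) : ℝ) * ρ ^ k, ?_, ?_⟩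
      · rw [hE]
        exact ⟨fun k => d k, hdN, rfl⟩
      · have hy : (1 - ρ) / N * ∑' k : ℕ, ((d k : ℕ) : ℝ) * ρ ^ k ∈ E := by
          rw [hE]
          exact ⟨fun k => d k, hdN, rfl⟩
        have heq := mul_left_cancel₀ hc.ne' (hx _ hy)
        set y := (1 - ρ) / N * ∑' k : ℕ, ((d k : ℕ) : ℝ) * ρ ^ k
        have h0 := eq_zero_of_tsum_intCast_mul_pow_eq_zero hρ0 hρ1 hsep
          (fun k => (habs (x y) (fun k => d k) (hxN y) hdN k).trans (by linarith))
          (by rw [hsub _ _ (hxN y) hdN, heq, sub_self])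
        funext k
        have := h0 k
        exact Fin.ext (by simp only; omega)
    · intro n y hy z hz heq hne
      rw [hdist y hy z hz, mul_assoc]
      refine mul_le_mul_of_nonneg_left ?_ hc.le
      rw [mul_comm]
      refine le_abs_tsum_intCast_mul_pow hρ0 hρ1
        (fun k => (habs _ _ (hxN y) (hxN z) k).trans (by linarith)) (fun k hk => ?_) ?_
      · have := Fin.ext_iff.1 (heq k hk)
        simp only at this
        omega
      · intro h
        exact hne (Fin.ext (by simp only; omega))
  have hs0 : 0 < s := by
    rw [← NNReal.coe_pos, hs]
    exact div_pos (Real.log_pos (by push_cast; linarith)) hlogρ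
  have hne : ∀ K : Set ℝ, dimH K = dimH E → K.Nonempty := fun K h => by
    rw [Set.nonempty_iff_ne_empty]
    rintro rfl
    rw [dimH_empty] at h
    rw [← h] at hEs
    simp [hs0.ne'] at hEs
  obtain ⟨a₀, ha₀⟩ := hne K₁ hd₁
  obtain ⟨b₀, hb₀⟩ := hne K₂ hd₂
  have hmem : ∀ a ∈ K₁, ∀ b ∈ K₂, a + b ∈ E := fun a ha b hb => hK (Set.add_mem_add ha hb)
  -- the digits of `a + b` split as a function of `a` plus a function of `b`
  have hsplit : ∀ a ∈ K₁, ∀ b ∈ K₂, ∀ k,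
      x (a + b) k + x (a₀ + b₀) k = x (a + b₀) k + x (a₀ + b) k := by
    intro a ha b hb k
    have h0 := eq_zero_of_tsum_intCast_mul_pow_eq_zero hρ0 hρ1 hsep
      (e := fun k => ((x (a + b) k : ℤ) - x (a + b₀) k) - ((x (a₀ + b) k : ℤ) - x (a₀ + b₀) k))
      (fun k => by
        have h1 := habs _ _ (hxN (a + b)) (hxN (a + b₀)) k
        have h2 := habs _ _ (hxN (a₀ + b)) (hxN (a₀ + b₀)) k
        rw [abs_le] at h1 h2 ⊢
        push_cast at h1 h2 ⊢
        constructor <;> linarith)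
      (by
        have hs1 := summable_mul_pow_of_abs_le hρ0 hρ1
          (habs _ _ (hxN (a + b)) (hxN (a + b₀)))
        have hs2 := summable_mul_pow_of_abs_le hρ0 hρ1
          (habs _ _ (hxN (a₀ + b)) (hxN (a₀ + b₀)))
        have h1 := hsub _ _ (hxN (a + b)) (hxN (a + b₀))
        have h2 := hsub _ _ (hxN (a₀ + b)) (hxN (a₀ + b₀))
        have h3 := hs1.tsum_sub hs2
        simp_rw [← sub_mul, ← Int.cast_sub] at h3
        rw [h3, h1, h2]
        refine mul_left_cancel₀ hc.ne' ?_
        rw [mul_zero, mul_sub, mul_sub, mul_sub, ← hx _ (hmem a ha b hb),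
          ← hx _ (hmem a ha b₀ hb₀), ← hx _ (hmem a₀ ha₀ b hb), ← hx _ (hmem a₀ ha₀ b₀ hb₀)]
        ring) k
    omega
  classical
  let A : ℕ → Finset ℕ := fun k => {i ∈ Finset.range (N + 1) | ∃ a ∈ K₁, x (a + b₀) k = i}
  let B : ℕ → Finset ℕ := fun k => {i ∈ Finset.range (N + 1) | ∃ b ∈ K₂, x (a₀ + b) k = i}
  have hA : ∀ a ∈ K₁, ∀ k, x (a + b₀) k ∈ A k := fun a ha k =>
    Finset.mem_filter.2 ⟨Finset.mem_range.2 (Nat.lt_succ_of_le (hxN _ k)), a, ha, rfl⟩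
  have hB : ∀ b ∈ K₂, ∀ k, x (a₀ + b) k ∈ B k := fun b hb k =>
    Finset.mem_filter.2 ⟨Finset.mem_range.2 (Nat.lt_succ_of_le (hxN _ k)), b, hb, rfl⟩
  have hcard : ∀ k, (A k).card + (B k).card ≤ N + 2 := by
    intro k
    have h1 := cauchy_davenport_add_of_linearOrder_isCancelAdd
      (s := A k) (t := B k) ⟨_, hA a₀ ha₀ k⟩ ⟨_, hB b₀ hb₀ k⟩
    have h2 : A k + B k ⊆ Finset.Icc (x (a₀ + b₀) k) (x (a₀ + b₀) k + N) := by
      intro i hi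
      obtain ⟨u, hu, v, hv, rfl⟩ := Finset.mem_add.1 hi
      obtain ⟨-, a, ha, rfl⟩ := Finset.mem_filter.1 hu
      obtain ⟨-, b, hb, rfl⟩ := Finset.mem_filter.1 hv
      have := hsplit a ha b hb k
      have := hxN (a + b) k
      rw [Finset.mem_Icc]
      omega
    have h3 := Finset.card_le_card h2
    rw [Nat.card_Icc] at h3
    omega
  let M : ℝ := (N + 2) / 2
  have hM : 1 < M := by simp only [M]; linarith
  have hprod : ∀ n, ∏ k ∈ Finset.range n, ((A k).card : ℝ) ≤ M ^ n ∨
      ∏ k ∈ Finset.range n, ((B k).card : ℝ) ≤ M ^ n := by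
    intro n
    by_contra! h
    have h1 : (∏ k ∈ Finset.range n, ((A k).card : ℝ)) * ∏ k ∈ Finset.range n, ((B k).card : ℝ)
        ≤ M ^ n * M ^ n := by
      rw [← Finset.prod_mul_distrib, ← mul_pow]
      refine (Finset.prod_le_prod (g := fun _ => M * M)
        (fun _ _ => mul_nonneg (Nat.cast_nonneg _) (Nat.cast_nonneg _))
        fun k _ => ?_).trans (by simp)
      have h2 : ((A k).card : ℝ) + (B k).card ≤ N + 2 := by exact_mod_cast hcard k
      simp only [M]
      nlinarith [sq_nonneg (((A k).card : ℝ) - (B k).card),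
        Nat.cast_nonneg (α := ℝ) (A k).card, Nat.cast_nonneg (α := ℝ) (B k).card]
    have h2 : 0 < M ^ n := by positivity
    exact absurd h1 (not_le.2 (mul_lt_mul'' h.1 h.2 h2.le h2.le))
  let r : NNReal := (Real.log M / -Real.log ρ).toNNReal
  have hr : (r : ℝ) = Real.log M / -Real.log ρ :=
    Real.coe_toNNReal _ (div_nonneg (Real.log_nonneg hM.le) hlogρ.le)
  have hrs : r < s := by
    rw [← NNReal.coe_lt_coe, hr, hs]
    refine (div_lt_div_iff_of_pos_right hlogρ).2 (Real.log_lt_log (by linarith) ?_)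
    simp only [M]
    push_cast
    linarith
  have hpow : ∀ (n : ℕ) (z : ℝ), z ≤ M ^ n → z * (ρ ^ n) ^ (r : ℝ) ≤ 1 := fun n z hz => by
    rw [hr, pow_rpow_log_div_neg_log hρ0 hρ1 (by linarith), ← div_eq_mul_inv]
    exact (div_le_one (by positivity)).2 hz
  have hclose : ∀ n, ∀ y ∈ E, ∀ z ∈ E, (∀ k < n, x y k = x z k) → dist y z ≤ 1 * ρ ^ n := by
    intro n y hy z hz h
    rw [hdist y hy z hz]
    have := abs_tsum_mul_pow_le hρ0 hρ1 (habs _ _ (hxN y) (hxN z)) (n := n)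
      fun k hk => by simp [h k hk]
    calc _ ≤ (1 - ρ) / N * (ρ ^ n * (N / (1 - ρ))) := mul_le_mul_of_nonneg_left this hc.le
      _ = 1 * ρ ^ n := by field_simp
  have hfreq := Filter.frequently_or_distrib.1
    (Filter.Frequently.of_forall (f := Filter.atTop) hprod)
  have hlt : ¬ dimH E ≤ r := fun h =>
    absurd (hEs.trans h) (not_le.2 (by exact_mod_cast hrs))
  rcases hfreq with h | h
  · refine hlt (hd₁ ▸ dimH_le_of_frequently_card_mul_le hρ0 hρ1 zero_le_one
      (p := fun a => x (a + b₀)) hA (fun n a ha a' ha' h => ?_) (h.mono fun n => hpow n _))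
    simpa using hclose n _ (hmem a ha b₀ hb₀) _ (hmem a' ha' b₀ hb₀) h
  · refine hlt (hd₂ ▸ dimH_le_of_frequently_card_mul_le hρ0 hρ1 zero_le_one
      (p := fun b => x (a₀ + b)) hB (fun n b hb b' hb' h => ?_) (h.mono fun n => hpow n _))
    simpa using hclose n _ (hmem a₀ ha₀ b hb) _ (hmem a₀ ha₀ b' hb') h
end
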